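/- arXiv:1710.06535 — 3 statements merged into one kernel-verified Lean document; each statement's English description precedes it below -/
import Mathlib

section
/- Let G be a 5-critical graph on n vertices (χ(G) = 5 and χ(G − v) = 4 for every vertex v). If G contains no clique of size 4 and no independent set of size 4, then for every real y ≥ 4, Q_G(y) ≤ (y+1)·y^{n-4}·(y-1)·(y-2)·(y-3). -/
/-- The number of proper colourings of `G` with `x` (labelled) colours. -/
noncomputable def numColorings {V : Type} (G : SimpleGraph V) (x : ℕ) : ℕ :=
  Nat.card {f : V → Fin x // ∀ u v : V, G.Adj u v → f u ≠ f v}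

/-- `G` is `5`-critical: `χ(G) = 5` and deleting any single vertex yields a graph of
chromatic number `4`. -/
def FiveCritical {V : Type} (G : SimpleGraph V) : Prop :=
  G.chromaticNumber = 5 ∧ ∀ v : V, (G.induce {u : V | u ≠ v}).chromaticNumber = 4

section Auxiliary

open Finset

section Packings

variable {V : Type*} [DecidableEq V]

open Classical in
/-- The `k`-element cliques of `H` contained in `S`. -/
noncomputable def cliquesIn (H : SimpleGraph V) (k : ℕ) (S : Finset V) : Finset (Finset V) :=
  {B ∈ S.powersetCard k | H.IsClique (B : Set V)}

/-- The number of sequences of `t` triangles followed by `p` edges of `H`, pairwise disjoint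
and contained in `S`. -/
noncomputable def packings (H : SimpleGraph V) : ℕ → ℕ → Finset V → ℕ
  | 0, 0, _ => 1
  | 0, p + 1, S => ∑ B ∈ cliquesIn H 2 S, packings H 0 p (S \ B)
  | t + 1, p, S => ∑ B ∈ cliquesIn H 3 S, packings H t p (S \ B)

/-- `S` can be partitioned into at most `m` cliques of `H`. -/
def CliqueCover (H : SimpleGraph V) (S : Finset V) (m : ℕ) : Prop :=
  ∃ c : V → ℕ, (∀ v ∈ S, c v < m) ∧ ∀ u ∈ S, ∀ v ∈ S, u ≠ v → ¬ H.Adj u v → c u ≠ c v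

variable {H : SimpleGraph V}

theorem mem_cliquesIn {k : ℕ} {S B : Finset V} :
    B ∈ cliquesIn H k S ↔ B ⊆ S ∧ B.card = k ∧ H.IsClique (B : Set V) := by
  simp [cliquesIn, mem_powersetCard, and_assoc]

theorem cliquesIn_one (S : Finset V) : cliquesIn H 1 S = S.image singleton := by
  ext B
  simp only [mem_cliquesIn, mem_image, card_eq_one]
  constructor
  · rintro ⟨h, ⟨v, rfl⟩, -⟩
    exact ⟨v, by simpa using h, rfl⟩
  · rintro ⟨v, hv, rfl⟩
    exact ⟨by simpa using hv, ⟨v, rfl⟩, by simp⟩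

theorem card_cliquesIn_one (S : Finset V) : (cliquesIn H 1 S).card = S.card := by
  rw [cliquesIn_one, card_image_of_injective _ singleton_injective]

theorem cliquesIn_zero (S : Finset V) : cliquesIn H 0 S = {∅} := by
  ext B
  simp only [mem_cliquesIn, card_eq_zero, mem_singleton]
  constructor
  · exact fun h => h.2.1
  · rintro rfl
    simp

theorem cliquesIn_mono {k : ℕ} {S S' : Finset V} (h : S ⊆ S') :
    cliquesIn H k S ⊆ cliquesIn H k S' := fun B hB => by
  rw [mem_cliquesIn] at *
  exact ⟨hB.1.trans h, hB.2⟩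

theorem card_sdiff_of_mem_cliquesIn {k : ℕ} {S B : Finset V} (h : B ∈ cliquesIn H k S) :
    (S \ B).card + k = S.card := by
  rw [mem_cliquesIn] at h
  rw [← h.2.1, card_sdiff_add_card_eq_card h.1]

theorem sum_cliquesIn_comm {M : Type*} [AddCommMonoid M] (i j : ℕ) (S : Finset V)
    (g : Finset V → M) :
    ∑ A ∈ cliquesIn H i S, ∑ B ∈ cliquesIn H j (S \ A), g ((S \ A) \ B) =
      ∑ B ∈ cliquesIn H j S, ∑ A ∈ cliquesIn H i (S \ B), g ((S \ B) \ A) := by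
  rw [sum_comm' (s' := fun B => cliquesIn H i (S \ B)) (t' := cliquesIn H j S)]
  · simp_rw [sdiff_right_comm]
  · intro A B
    simp only [mem_cliquesIn, subset_sdiff]
    tauto

theorem sum_cliquesIn_two_packings (t p : ℕ) (S : Finset V) :
    ∑ B ∈ cliquesIn H 2 S, packings H t p (S \ B) = packings H t (p + 1) S := by
  induction t generalizing S with
  | zero => simp only [packings]
  | succ t ih =>
    simp only [packings]
    rw [sum_cliquesIn_comm 2 3 S (packings H t p)]
    exact sum_congr rfl fun B _ => ih _

theorem sum_cliquesIn_one_packings (t p : ℕ) (S : Finset V) :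
    ∑ B ∈ cliquesIn H 1 S, packings H t p (S \ B) =
      (S.card - 3 * t - 2 * p) * packings H t p S := by
  induction t generalizing S with
  | zero =>
    induction p generalizing S with
    | zero => simp [packings, card_cliquesIn_one]
    | succ p ih =>
      simp only [packings]
      rw [sum_cliquesIn_comm 1 2 S (packings H 0 p), mul_sum]
      refine sum_congr rfl fun B hB => ?_
      rw [ih, ← card_sdiff_of_mem_cliquesIn hB]
      congr 1
      omega
  | succ t ih =>
    simp only [packings]
    rw [sum_cliquesIn_comm 1 3 S (packings H t p), mul_sum]
    refine sum_congr rfl fun B hB => ?_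
    rw [ih, ← card_sdiff_of_mem_cliquesIn hB]
    congr 1
    omega

theorem packings_eq_zero_of_card_lt {t p : ℕ} {S : Finset V} (h : S.card < 3 * t + 2 * p) :
    packings H t p S = 0 := by
  induction t generalizing S with
  | zero =>
    induction p generalizing S with
    | zero => omega
    | succ p ih =>
      simp only [packings]
      refine sum_eq_zero fun B hB => ih ?_
      have := card_sdiff_of_mem_cliquesIn hB
      omega
  | succ t ih =>
    simp only [packings]
    refine sum_eq_zero fun B hB => ih ?_
    have := card_sdiff_of_mem_cliquesIn hB
    omega

theorem descFactorial_succ_left (x k : ℕ) :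
    (x + 1).descFactorial k = x.descFactorial k + k * x.descFactorial (k - 1) := by
  cases k with
  | zero => simp
  | succ j =>
    rw [Nat.succ_descFactorial_succ, Nat.descFactorial_succ, Nat.add_sub_cancel, ← add_mul]
    rcases le_or_gt j x with h | h
    · congr 1
      omega
    · simp [Nat.descFactorial_of_lt h]

theorem sum_sum_cliquesIn_one (K x : ℕ) (S : Finset V) :
    ∑ B ∈ cliquesIn H 1 S, ∑ t ∈ range K, ∑ p ∈ range K,
      (packings H t p (S \ B) : ℝ) / (t.factorial * p.factorial) *
        x.descFactorial ((S \ B).card - 2 * t - p) =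
    ∑ t ∈ range K, ∑ p ∈ range K, (packings H t p S : ℝ) / (t.factorial * p.factorial) *
      ((S.card - 3 * t - 2 * p : ℕ) * x.descFactorial (S.card - 2 * t - p - 1)) := by
  rw [sum_comm]
  refine sum_congr rfl fun t _ => ?_
  rw [sum_comm]
  refine sum_congr rfl fun p _ => ?_
  have h := sum_cliquesIn_one_packings (H := H) t p S
  have h' : (∑ B ∈ cliquesIn H 1 S, (packings H t p (S \ B) : ℝ)) =
      (S.card - 3 * t - 2 * p : ℕ) * packings H t p S := mod_cast h
  rw [show (packings H t p S : ℝ) / (t.factorial * p.factorial) *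
      ((S.card - 3 * t - 2 * p : ℕ) * x.descFactorial (S.card - 2 * t - p - 1)) =
      ((S.card - 3 * t - 2 * p : ℕ) * packings H t p S) *
        (x.descFactorial (S.card - 2 * t - p - 1) / (t.factorial * p.factorial)) by ring,
    ← h', sum_mul]
  refine sum_congr rfl fun B hB => ?_
  have := card_sdiff_of_mem_cliquesIn hB
  rw [show (S \ B).card - 2 * t - p = S.card - 2 * t - p - 1 by omega]
  ring

theorem sum_sum_cliquesIn_two (K x : ℕ) (S : Finset V) (hS : S.card < K) :
    ∑ B ∈ cliquesIn H 2 S, ∑ t ∈ range K, ∑ p ∈ range K,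
      (packings H t p (S \ B) : ℝ) / (t.factorial * p.factorial) *
        x.descFactorial ((S \ B).card - 2 * t - p) =
    ∑ t ∈ range K, ∑ p ∈ range K, (packings H t p S : ℝ) / (t.factorial * p.factorial) *
      (p * x.descFactorial (S.card - 2 * t - p - 1)) := by
  rw [sum_comm]
  refine sum_congr rfl fun t _ => ?_
  have hlast : ∑ p ∈ range (K + 1), (packings H t p S : ℝ) / (t.factorial * p.factorial) *
      (p * x.descFactorial (S.card - 2 * t - p - 1)) =
      ∑ p ∈ range K, (packings H t p S : ℝ) / (t.factorial * p.factorial) *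
      (p * x.descFactorial (S.card - 2 * t - p - 1)) := by
    rw [sum_range_succ, packings_eq_zero_of_card_lt (by omega : S.card < 3 * t + 2 * K)]
    simp
  rw [sum_comm, ← hlast, sum_range_succ']
  simp only [CharP.cast_eq_zero, zero_mul, mul_zero, add_zero]
  refine sum_congr rfl fun p _ => ?_
  have h' : (∑ B ∈ cliquesIn H 2 S, (packings H t p (S \ B) : ℝ)) =
      packings H t (p + 1) S := mod_cast sum_cliquesIn_two_packings (H := H) t p S
  rw [← h', sum_div, sum_mul]
  refine sum_congr rfl fun B hB => ?_
  have := card_sdiff_of_mem_cliquesIn hB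
  rw [show (S \ B).card - 2 * t - p = S.card - 2 * t - (p + 1) - 1 by omega, Nat.factorial_succ]
  have : (p + 1 : ℝ) ≠ 0 := by positivity
  have : (p.factorial : ℝ) ≠ 0 := by positivity
  have : (t.factorial : ℝ) ≠ 0 := by positivity
  push_cast
  field_simp

theorem sum_sum_cliquesIn_three (K x : ℕ) (S : Finset V) (hS : S.card < K) :
    ∑ B ∈ cliquesIn H 3 S, ∑ t ∈ range K, ∑ p ∈ range K,
      (packings H t p (S \ B) : ℝ) / (t.factorial * p.factorial) *
        x.descFactorial ((S \ B).card - 2 * t - p) =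
    ∑ t ∈ range K, ∑ p ∈ range K, (packings H t p S : ℝ) / (t.factorial * p.factorial) *
      (t * x.descFactorial (S.card - 2 * t - p - 1)) := by
  have hlast : ∑ t ∈ range (K + 1), ∑ p ∈ range K,
      (packings H t p S : ℝ) / (t.factorial * p.factorial) *
      (t * x.descFactorial (S.card - 2 * t - p - 1)) =
      ∑ t ∈ range K, ∑ p ∈ range K, (packings H t p S : ℝ) / (t.factorial * p.factorial) *
      (t * x.descFactorial (S.card - 2 * t - p - 1)) := by
    rw [sum_range_succ, add_eq_left]
    refine sum_eq_zero fun p _ => ?_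
    rw [packings_eq_zero_of_card_lt (by omega : S.card < 3 * K + 2 * p)]
    simp
  rw [sum_comm, ← hlast, sum_range_succ']
  simp only [CharP.cast_eq_zero, zero_mul, mul_zero, add_zero, sum_const_zero]
  refine sum_congr rfl fun t _ => ?_
  rw [sum_comm]
  refine sum_congr rfl fun p _ => ?_
  have h' : (∑ B ∈ cliquesIn H 3 S, (packings H t p (S \ B) : ℝ)) =
      packings H (t + 1) p S := by simp [packings]
  rw [← h', sum_div, sum_mul]
  refine sum_congr rfl fun B hB => ?_
  have := card_sdiff_of_mem_cliquesIn hB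
  rw [show (S \ B).card - 2 * t - p = S.card - 2 * (t + 1) - p - 1 by omega, Nat.factorial_succ]
  have : (t + 1 : ℝ) ≠ 0 := by positivity
  have : (p.factorial : ℝ) ≠ 0 := by positivity
  have : (t.factorial : ℝ) ≠ 0 := by positivity
  push_cast
  field_simp

end Packings

section Expansion

variable {V : Type*} [Fintype V] [DecidableEq V]

open Classical in
/-- The functions `V → ℕ` vanishing off `S` whose restriction to `S` takes values below `x` and
has cliques of `H` as fibres. -/
noncomputable def coverings (H : SimpleGraph V) (S : Finset V) (x : ℕ) : Finset (V → ℕ) :=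
  {c ∈ Fintype.piFinset fun v => if v ∈ S then range x else {0} |
    ∀ u ∈ S, ∀ v ∈ S, u ≠ v → ¬ H.Adj u v → c u ≠ c v}

variable {H : SimpleGraph V}

theorem mem_coverings {S : Finset V} {x : ℕ} {c : V → ℕ} :
    c ∈ coverings H S x ↔ (∀ v ∈ S, c v < x) ∧ (∀ v ∉ S, c v = 0) ∧
      ∀ u ∈ S, ∀ v ∈ S, u ≠ v → ¬ H.Adj u v → c u ≠ c v := by
  simp only [coverings, mem_filter, Fintype.mem_piFinset, ← and_assoc]
  refine and_congr_left fun _ => ⟨fun h => ⟨fun v hv => ?_, fun v hv => ?_⟩, fun h v => ?_⟩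
  · simpa [hv] using h v
  · simpa [hv] using h v
  · by_cases hv : v ∈ S
    · simpa [hv] using h.1 v hv
    · simpa [hv] using h.2 v hv

theorem card_coverings_zero (S : Finset V) :
    (coverings H S 0).card = if S.card = 0 then 1 else 0 := by
  split_ifs with h
  · rw [card_eq_zero] at h
    subst h
    rw [card_eq_one]
    refine ⟨0, ?_⟩
    ext c
    simp [mem_coverings, funext_iff]
  · rw [card_eq_zero, eq_empty_iff_forall_notMem]
    intro c hc
    obtain ⟨v, hv⟩ := card_pos.mp (Nat.pos_of_ne_zero h)
    exact absurd ((mem_coverings.mp hc).1 v hv) (by omega)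

open Classical in
theorem card_coverings_succ_powerset (S : Finset V) (x : ℕ) :
    (coverings H S (x + 1)).card =
      ∑ B ∈ ({B ∈ S.powerset | H.IsClique (B : Set V)} : Finset (Finset V)),
        (coverings H (S \ B) x).card := by
  rw [card_eq_sum_card_fiberwise (f := fun c => {v ∈ S | c v = x})
    (t := {B ∈ S.powerset | H.IsClique (B : Set V)})]
  · refine sum_congr rfl fun B hB => ?_
    rw [mem_filter, mem_powerset] at hB
    refine card_nbij' (fun c v => if v ∈ B then 0 else c v) (fun c v => if v ∈ B then x else c v)
      ?_ ?_ ?_ ?_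
    · intro c hc
      simp only [mem_coe, mem_filter, mem_coverings] at hc
      obtain ⟨⟨h1, h2, h3⟩, rfl⟩ := hc
      simp only [mem_coe, mem_coverings, mem_sdiff, mem_filter, not_and]
      refine ⟨?_, ?_, ?_⟩
      · rintro v ⟨hv, hx⟩
        have := h1 v hv
        have := hx hv
        rw [if_neg (by tauto)]
        omega
      · intro v hv
        split_ifs with h
        · rfl
        · exact h2 v fun h' => hv h' fun _ hx => h ⟨h', hx⟩
      · rintro u ⟨hu, hux⟩ v ⟨hv, hvx⟩ huv hadj
        rw [if_neg (by tauto), if_neg (by tauto)]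
        exact h3 u hu v hv huv hadj
    · intro c hc
      simp only [mem_coe, mem_coverings, mem_sdiff, not_and, not_not] at hc
      obtain ⟨h1, h2, h3⟩ := hc
      simp only [mem_coe, mem_filter, mem_coverings]
      refine ⟨⟨?_, ?_, ?_⟩, ?_⟩
      · intro v hv
        split_ifs with h
        · omega
        · have := h1 v ⟨hv, h⟩
          omega
      · intro v hv
        rw [if_neg fun h => hv (hB.1 h)]
        exact h2 v fun h => absurd h hv
      · intro u hu v hv huv hadj
        split_ifs with h h' h'
        · exact absurd (hB.2 h h' huv) hadj
        · have := h1 v ⟨hv, h'⟩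
          omega
        · have := h1 u ⟨hu, h⟩
          omega
        · exact h3 u ⟨hu, h⟩ v ⟨hv, h'⟩ huv hadj
      · ext v
        simp only [mem_filter]
        constructor
        · rintro ⟨hv, h⟩
          by_contra hvB
          rw [if_neg hvB] at h
          have := h1 v ⟨hv, hvB⟩
          omega
        · intro h
          exact ⟨hB.1 h, by simp [h]⟩
    · intro c hc
      simp only [mem_coe, mem_filter, mem_coverings] at hc
      obtain ⟨-, rfl⟩ := hc
      ext v
      by_cases h : v ∈ S ∧ c v = x <;> simp [h]
    · intro c hc
      simp only [mem_coe, mem_coverings, mem_sdiff, not_and, not_not] at hc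
      ext v
      by_cases h : v ∈ B
      · simpa [h] using (hc.2.1 v fun _ => h).symm
      · simp [h]
  · intro c hc
    rw [mem_coe, mem_coverings] at hc
    rw [mem_coe, mem_filter, mem_powerset]
    refine ⟨filter_subset _ _, fun u hu v hv huv => ?_⟩
    rw [mem_coe, mem_filter] at hu hv
    by_contra h
    exact hc.2.2 u hu.1 v hv.1 huv h (hu.2.trans hv.2.symm)

theorem card_coverings_succ (hH : H.CliqueFree 4) (S : Finset V) (x : ℕ) :
    (coverings H S (x + 1)).card = (coverings H S x).card +
      ∑ B ∈ cliquesIn H 1 S, (coverings H (S \ B) x).card +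
      ∑ B ∈ cliquesIn H 2 S, (coverings H (S \ B) x).card +
      ∑ B ∈ cliquesIn H 3 S, (coverings H (S \ B) x).card := by
  classical
  rw [card_coverings_succ_powerset, ← sum_fiberwise_of_maps_to
    (s := ({B ∈ S.powerset | H.IsClique (B : Set V)} : Finset (Finset V)))
    (g := card) (t := range 4)]
  · have key : ∀ k, ({B ∈ {B ∈ S.powerset | H.IsClique (B : Set V)} | B.card = k} :
        Finset (Finset V)) = cliquesIn H k S := by
      intro k
      ext B
      simp only [mem_filter, mem_powerset, mem_cliquesIn]
      tauto
    simp_rw [key]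
    simp [sum_range_succ, cliquesIn_zero]
  · intro B hB
    rw [mem_filter] at hB
    rw [mem_range]
    by_contra h
    obtain ⟨C, hC, hcard⟩ := exists_subset_card_eq (not_lt.mp h)
    exact hH C ⟨hB.2.subset (mod_cast hC), hcard⟩

/-- The expansion of the chromatic polynomial of `Hᶜ` in falling factorials. -/
theorem card_coverings_eq_sum (hH : H.CliqueFree 4) (K x : ℕ) (S : Finset V) (hS : S.card < K) :
    ((coverings H S x).card : ℝ) = ∑ t ∈ range K, ∑ p ∈ range K,
      (packings H t p S : ℝ) / (t.factorial * p.factorial) *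
        x.descFactorial (S.card - 2 * t - p) := by
  induction x generalizing S with
  | zero =>
    rw [card_coverings_zero]
    split_ifs with h
    · have hK : 0 < K := by omega
      rw [sum_eq_single_of_mem 0 (mem_range.mpr hK), sum_eq_single_of_mem 0 (mem_range.mpr hK)]
      · simp [h, packings]
      · intro p _ hp
        rw [packings_eq_zero_of_card_lt (by omega)]
        simp
      · intro t _ ht
        refine sum_eq_zero fun p _ => ?_
        rw [packings_eq_zero_of_card_lt (by omega)]
        simp
    · rw [Nat.cast_zero, eq_comm]
      refine sum_eq_zero fun t _ => sum_eq_zero fun p _ => ?_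
      rcases lt_or_ge S.card (3 * t + 2 * p) with h' | h'
      · rw [packings_eq_zero_of_card_lt h']
        simp
      · rw [Nat.descFactorial_of_lt (by omega)]
        simp
  | succ x ih =>
    have hB : ∀ k, ∑ B ∈ cliquesIn H k S, ((coverings H (S \ B) x).card : ℝ) =
        ∑ B ∈ cliquesIn H k S, ∑ t ∈ range K, ∑ p ∈ range K,
          (packings H t p (S \ B) : ℝ) / (t.factorial * p.factorial) *
          x.descFactorial ((S \ B).card - 2 * t - p) := fun k =>
      sum_congr rfl fun B _ => ih _ ((card_le_card sdiff_subset).trans_lt hS)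
    rw [card_coverings_succ hH]
    push_cast
    rw [hB, hB, hB, ih S hS, sum_sum_cliquesIn_one, sum_sum_cliquesIn_two K x S hS,
      sum_sum_cliquesIn_three K x S hS]
    simp only [← sum_add_distrib]
    refine sum_congr rfl fun t _ => sum_congr rfl fun p _ => ?_
    rcases lt_or_ge S.card (3 * t + 2 * p) with h | h
    · simp [packings_eq_zero_of_card_lt h]
    · rw [descFactorial_succ_left,
        show S.card - 2 * t - p = (S.card - 3 * t - 2 * p) + p + t by omega]
      push_cast
      ring

end Expansion

section ChromaticPolynomial

variable {V : Type} [Fintype V] [DecidableEq V]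

theorem numColorings_eq_card_coverings (G : SimpleGraph V) (x : ℕ) :
    numColorings G x = (coverings Gᶜ univ x).card := by
  rw [numColorings, ← Nat.card_eq_finsetCard]
  refine Nat.card_congr ⟨fun f => ⟨fun v => (f.1 v : ℕ), ?_⟩,
    fun c => ⟨fun v => ⟨c.1 v, (mem_coverings.mp c.2).1 v (mem_univ v)⟩, ?_⟩,
    fun f => rfl, fun c => rfl⟩
  · refine mem_coverings.mpr ⟨fun v _ => (f.1 v).2, fun v hv => absurd (mem_univ v) hv,
      fun u _ v _ huv h heq => f.2 u v ?_ (Fin.ext heq)⟩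
    rw [SimpleGraph.compl_adj] at h
    tauto
  · intro u v huv heq
    refine (mem_coverings.mp c.2).2.2 u (mem_univ u) v (mem_univ v) huv.ne ?_
      (congrArg Fin.val heq)
    rw [SimpleGraph.compl_adj]
    tauto

/-- A polynomial interpolating the numbers of colourings of `G` agrees everywhere with the
expansion in falling factorials. -/
theorem eval_eq_sum_packings (G : SimpleGraph V) (hH : Gᶜ.CliqueFree 4) (P : Polynomial ℝ)
    (hP : ∀ x : ℕ, P.eval (x : ℝ) = numColorings G x) (K : ℕ) (hK : Fintype.card V < K) (r : ℝ) :
    P.eval r = ∑ t ∈ range K, ∑ p ∈ range K,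
      (packings Gᶜ t p univ : ℝ) / (t.factorial * p.factorial) *
        (descPochhammer ℝ (Fintype.card V - 2 * t - p)).eval r := by
  have : P = ∑ t ∈ range K, ∑ p ∈ range K,
      Polynomial.C ((packings Gᶜ t p univ : ℝ) / (t.factorial * p.factorial)) *
        descPochhammer ℝ (Fintype.card V - 2 * t - p) := by
    refine Polynomial.eq_of_infinite_eval_eq _ _
      ((Set.infinite_range_of_injective (Nat.cast_injective (R := ℝ))).mono ?_)
    rintro _ ⟨x, rfl⟩
    change P.eval (x : ℝ) = _
    rw [hP, numColorings_eq_card_coverings, card_coverings_eq_sum hH K x univ hK]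
    simp [Polynomial.eval_finsetSum, descPochhammer_eval_eq_descFactorial]
  rw [this]
  simp [Polynomial.eval_finsetSum]

end ChromaticPolynomial

section Covers

variable {V : Type*} [DecidableEq V] {H : SimpleGraph V} {S : Finset V}

theorem CliqueCover.of_card_le {m : ℕ} (h : S.card ≤ m) : CliqueCover H S m := by
  refine ⟨fun v => if hv : v ∈ S then S.equivFin ⟨v, hv⟩ else 0, fun v hv => ?_, ?_⟩
  · simp only [hv, dif_pos]
    exact (Fin.is_lt _).trans_le h
  · intro u hu v hv huv _ heq
    simp only [hu, hv, dif_pos] at heq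
    have := S.equivFin.injective (Fin.ext heq)
    exact huv (by simpa using this)

theorem CliqueCover.of_sdiff {B : Finset V} {m : ℕ} (hB : H.IsClique (B : Set V))
    (h : CliqueCover H (S \ B) m) : CliqueCover H S (m + 1) := by
  obtain ⟨c, h1, h2⟩ := h
  refine ⟨fun v => if v ∈ B then m else c v, fun v hv => ?_, fun u hu v hv huv hadj => ?_⟩
  · dsimp only
    split_ifs with hvB
    · omega
    · have := h1 v (mem_sdiff.mpr ⟨hv, hvB⟩)
      omega
  · dsimp only
    split_ifs with huB hvB hvB
    · exact absurd (hB huB hvB huv) hadj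
    · have := h1 v (mem_sdiff.mpr ⟨hv, hvB⟩)
      omega
    · have := h1 u (mem_sdiff.mpr ⟨hu, huB⟩)
      omega
    · exact h2 u (mem_sdiff.mpr ⟨hu, huB⟩) v (mem_sdiff.mpr ⟨hv, hvB⟩) huv hadj

theorem CliqueCover.of_packings_ne_zero {t p m : ℕ} (h : packings H t p S ≠ 0)
    (hm : S.card ≤ m + 2 * t + p) : CliqueCover H S m := by
  induction t generalizing S m with
  | zero =>
    induction p generalizing S m with
    | zero => exact .of_card_le hm
    | succ p ih =>
      simp only [packings] at h
      obtain ⟨B, hB, hne⟩ := exists_ne_zero_of_sum_ne_zero h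
      have hcard := card_sdiff_of_mem_cliquesIn hB
      have hle := le_of_not_gt fun h' => hne (packings_eq_zero_of_card_lt h')
      obtain ⟨m, rfl⟩ : ∃ m', m = m' + 1 := ⟨m - 1, by omega⟩
      exact .of_sdiff (mem_cliquesIn.mp hB).2.2 (ih hne (by omega))
  | succ t ih =>
    simp only [packings] at h
    obtain ⟨B, hB, hne⟩ := exists_ne_zero_of_sum_ne_zero h
    have hcard := card_sdiff_of_mem_cliquesIn hB
    have hle := le_of_not_gt fun h' => hne (packings_eq_zero_of_card_lt h')
    obtain ⟨m, rfl⟩ : ∃ m', m = m' + 1 := ⟨m - 1, by omega⟩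
    exact .of_sdiff (mem_cliquesIn.mp hB).2.2 (ih hne (by omega))

end Covers

section Links

variable {V : Type*}

open Classical in
/-- The vertices of `S` that are adjacent in `H` to every vertex of `B`. -/
noncomputable def link (H : SimpleGraph V) (S B : Finset V) : Finset V :=
  {w ∈ S | ∀ b ∈ B, H.Adj b w}

variable {H : SimpleGraph V} {S : Finset V}

theorem mem_link {B : Finset V} {w : V} : w ∈ link H S B ↔ w ∈ S ∧ ∀ b ∈ B, H.Adj b w := by
  simp [link]

theorem mem_link_singleton {v w : V} : w ∈ link H S {v} ↔ w ∈ S ∧ H.Adj v w := by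
  simp [link]

variable [DecidableEq V]

omit [DecidableEq V] in
theorem link_subset (B : Finset V) : link H S B ⊆ S := fun _ h => (mem_link.mp h).1

omit [DecidableEq V] in
theorem link_mono {S' : Finset V} (h : S ⊆ S') (B : Finset V) : link H S B ⊆ link H S' B :=
  fun _ hw => mem_link.mpr ⟨h (mem_link.mp hw).1, (mem_link.mp hw).2⟩

theorem singleton_mem_cliquesIn {v : V} (hv : v ∈ S) : {v} ∈ cliquesIn H 1 S :=
  mem_cliquesIn.mpr ⟨by simpa using hv, by simp, by simp⟩

theorem pair_mem_cliquesIn {u v : V} (hu : u ∈ S) (hv : v ∈ S) (h : H.Adj u v) :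
    {u, v} ∈ cliquesIn H 2 S := by
  refine mem_cliquesIn.mpr ⟨?_, card_pair h.ne, ?_⟩
  · simp [insert_subset_iff, hu, hv]
  · simpa [SimpleGraph.isClique_pair] using fun _ => h

theorem exists_pair_of_mem_cliquesIn {B : Finset V} (hB : B ∈ cliquesIn H 2 S) :
    ∃ u ∈ S, ∃ v ∈ S, H.Adj u v ∧ B = {u, v} := by
  obtain ⟨h1, h2, h3⟩ := mem_cliquesIn.mp hB
  obtain ⟨u, v, huv, rfl⟩ := card_eq_two.mp h2
  exact ⟨u, h1 (by simp), v, h1 (by simp), h3 (by simp) (by simp) huv, rfl⟩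

theorem union_mem_cliquesIn {j k : ℕ} {A B : Finset V} (hA : A ∈ cliquesIn H j S)
    (hB : B ∈ cliquesIn H k (link H S A)) :
    A ∪ B ∈ cliquesIn H (j + k) S ∧ Disjoint A B := by
  rw [mem_cliquesIn] at *
  have hAB : Disjoint A B := by
    rw [disjoint_left]
    intro v hvA hvB
    exact (mem_link.mp (hB.1 hvB)).2 v hvA |>.ne rfl
  refine ⟨⟨union_subset hA.1 (hB.1.trans (link_subset A)), ?_, ?_⟩, hAB⟩
  · rw [card_union_of_disjoint hAB, hA.2.1, hB.2.1]
  · intro x hx y hy hxy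
    simp only [coe_union, Set.mem_union, mem_coe] at hx hy
    rcases hx with hx | hx <;> rcases hy with hy | hy
    · exact hA.2.2 hx hy hxy
    · exact (mem_link.mp (hB.1 hy)).2 x hx
    · exact ((mem_link.mp (hB.1 hx)).2 y hy).symm
    · exact hB.2.2 hx hy hxy

theorem card_filter_subset_cliquesIn {j : ℕ} (k : ℕ) {A : Finset V} (hA : A ∈ cliquesIn H j S) :
    #{C ∈ cliquesIn H (j + k) S | A ⊆ C} = #(cliquesIn H k (link H S A)) := by
  refine card_nbij' (fun C => C \ A) (fun B => A ∪ B) ?_ ?_ ?_ ?_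
  · intro C hC
    simp only [mem_coe, mem_filter] at hC ⊢
    obtain ⟨hC, hAC⟩ := hC
    have hA' := mem_cliquesIn.mp hA
    rw [mem_cliquesIn] at *
    refine ⟨fun v hv => mem_link.mpr ⟨hC.1 (mem_sdiff.mp hv).1, fun a ha => ?_⟩, ?_, ?_⟩
    · exact hC.2.2 (hAC ha) (mem_sdiff.mp hv).1 fun h => (mem_sdiff.mp hv).2 (h ▸ ha)
    · rw [card_sdiff_of_subset hAC, hC.2.1, hA'.2.1, Nat.add_sub_cancel_left]
    · exact hC.2.2.subset (by simp)
  · intro B hB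
    simp only [mem_coe, mem_filter] at hB ⊢
    exact ⟨(union_mem_cliquesIn hA hB).1, subset_union_left⟩
  · intro C hC
    simp only [mem_coe, mem_filter] at hC
    exact union_sdiff_of_subset hC.2
  · intro B hB
    exact union_sdiff_cancel_left (union_mem_cliquesIn hA hB).2

theorem sum_card_cliquesIn_link (j k : ℕ) (S : Finset V) :
    ∑ A ∈ cliquesIn H j S, #(cliquesIn H k (link H S A)) =
      (j + k).choose j * #(cliquesIn H (j + k) S) := by
  calc _ = ∑ A ∈ cliquesIn H j S, #{C ∈ cliquesIn H (j + k) S | A ⊆ C} :=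
        sum_congr rfl fun A hA => (card_filter_subset_cliquesIn k hA).symm
    _ = ∑ C ∈ cliquesIn H (j + k) S, #{A ∈ cliquesIn H j S | A ⊆ C} :=
        sum_card_bipartiteAbove_eq_sum_card_bipartiteBelow _
    _ = ∑ C ∈ cliquesIn H (j + k) S, (j + k).choose j := by
        refine sum_congr rfl fun C hC => ?_
        have hC' := mem_cliquesIn.mp hC
        rw [← hC'.2.1, ← card_powersetCard]
        congr 1
        ext A
        simp only [mem_filter, mem_cliquesIn, mem_powersetCard]
        exact ⟨fun h => ⟨h.2, h.1.2.1⟩,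
          fun h => ⟨⟨h.1.trans hC'.1, h.2, hC'.2.2.subset (mod_cast h.1)⟩, h.1⟩⟩
    _ = _ := by rw [sum_const, smul_eq_mul, mul_comm]

theorem sum_cliquesIn_one (S : Finset V) (f : Finset V → ℕ) :
    ∑ A ∈ cliquesIn H 1 S, f A = ∑ v ∈ S, f {v} := by
  rw [cliquesIn_one, sum_image fun _ _ _ _ h => singleton_injective h]

/-- The handshake lemma. -/
theorem sum_card_link_singleton (S : Finset V) :
    ∑ v ∈ S, #(link H S {v}) = 2 * #(cliquesIn H 2 S) := by
  have := sum_card_cliquesIn_link (H := H) 1 1 S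
  rw [sum_cliquesIn_one] at this
  simpa [card_cliquesIn_one] using this

theorem sum_card_cliquesIn_two_link (S : Finset V) :
    ∑ v ∈ S, #(cliquesIn H 2 (link H S {v})) = 3 * #(cliquesIn H 3 S) := by
  have := sum_card_cliquesIn_link (H := H) 1 2 S
  rw [sum_cliquesIn_one] at this
  simpa using this

theorem sum_card_link (S : Finset V) :
    ∑ B ∈ cliquesIn H 2 S, #(link H S B) = 3 * #(cliquesIn H 3 S) := by
  simpa [card_cliquesIn_one] using sum_card_cliquesIn_link (H := H) 2 1 S

theorem card_cliquesIn_succ (k : ℕ) {v : V} (hv : v ∈ S) :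
    #(cliquesIn H (k + 1) S) =
      #(cliquesIn H (k + 1) (S.erase v)) + #(cliquesIn H k (link H S {v})) := by
  rw [← card_filter_subset_cliquesIn k (singleton_mem_cliquesIn hv), add_comm 1 k,
    ← card_filter_add_card_filter_not (fun C => {v} ⊆ C), add_comm]
  congr 2
  ext C
  simp only [mem_filter, mem_cliquesIn, singleton_subset_iff, subset_erase]
  tauto

theorem card_link_singleton_sdiff (S : Finset V) {B : Finset V} (hB : B ⊆ S) (v : V) :
    #(link H (S \ B) {v}) + #(link H B {v}) = #(link H S {v}) := by
  rw [← card_union_of_disjoint]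
  · congr 1
    ext w
    simp only [mem_union, mem_link_singleton, mem_sdiff]
    have := @hB w
    tauto
  · rw [disjoint_left]
    intro w
    simp only [mem_link_singleton, mem_sdiff]
    tauto

theorem link_insert_singleton (S : Finset V) (v : V) : link H (insert v S) {v} = link H S {v} := by
  ext w
  simp only [mem_link_singleton, mem_insert]
  constructor
  · rintro ⟨rfl | h, h'⟩
    · exact absurd rfl h'.ne
    · exact ⟨h, h'⟩
  · tauto

theorem card_cliquesIn_two_sdiff {B : Finset V} (hB : B ⊆ S) :
    #(cliquesIn H 2 (S \ B)) + ∑ v ∈ B, #(link H S {v}) =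
      #(cliquesIn H 2 S) + #(cliquesIn H 2 B) := by
  induction B using Finset.induction with
  | empty => simp [cliquesIn]
  | insert v B hv ih =>
    rw [insert_subset_iff] at hB
    have h1 := card_cliquesIn_succ (H := H) 1 (mem_sdiff.mpr ⟨hB.1, hv⟩)
    have h2 := card_cliquesIn_succ (H := H) 1 (mem_insert_self v B)
    rw [erase_insert hv, link_insert_singleton] at h2
    rw [← sdiff_insert] at h1
    have h3 := card_link_singleton_sdiff (H := H) S hB.2 v
    have h4 := ih hB.2
    simp only [Nat.reduceAdd, card_cliquesIn_one] at h1 h2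
    rw [sum_insert hv]
    omega

theorem card_cliquesIn_self {B : Finset V} {k : ℕ} (hB : B ∈ cliquesIn H k S) (j : ℕ) :
    #(cliquesIn H j B) = k.choose j := by
  rw [mem_cliquesIn] at hB
  rw [← hB.2.1, ← card_powersetCard]
  congr 1
  ext A
  simp only [mem_cliquesIn, mem_powersetCard]
  exact ⟨fun h => ⟨h.1, h.2.1⟩, fun h => ⟨h.1, h.2, hB.2.2.subset (mod_cast h.1)⟩⟩

omit [DecidableEq V] in
theorem sum_card_link_le (S B : Finset V) :
    ∑ v ∈ B, #(link H S {v}) ≤ (#B - 1) * #S + #(link H S B) := by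
  classical
  have h1 : ∑ v ∈ B, #(link H S {v}) = ∑ w ∈ S, #{v ∈ B | H.Adj v w} := by
    refine (sum_congr rfl fun v _ => ?_).trans
      (sum_card_bipartiteAbove_eq_sum_card_bipartiteBelow fun v w => H.Adj v w)
    congr 1
    ext w
    simp [mem_link_singleton, bipartiteAbove]
  have h2 : link H S B = {w ∈ S | ∀ b ∈ B, H.Adj b w} := by
    ext w
    simp [mem_link]
  rw [h1, h2, card_filter, mul_comm, ← smul_eq_mul, ← sum_const, ← sum_add_distrib]
  refine sum_le_sum fun w _ => ?_
  split_ifs with h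
  · have := card_filter_le B fun v => H.Adj v w
    omega
  · push Not at h
    obtain ⟨b, hb, hb'⟩ := h
    have : #{v ∈ B | H.Adj v w} < #B := card_lt_card ((filter_ssubset).mpr ⟨b, hb, hb'⟩)
    omega

theorem sum_sum_card_link (S : Finset V) :
    ∑ B ∈ cliquesIn H 2 S, ∑ v ∈ B, #(link H S {v}) = ∑ v ∈ S, #(link H S {v}) ^ 2 := by
  rw [sum_comm' (s' := fun v => {B ∈ cliquesIn H 2 S | {v} ⊆ B}) (t' := S)]
  · refine sum_congr rfl fun v hv => ?_
    rw [sum_const, card_filter_subset_cliquesIn (j := 1) 1 (singleton_mem_cliquesIn hv),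
      card_cliquesIn_one, smul_eq_mul, sq]
  · intro B v
    simp only [mem_filter, singleton_subset_iff]
    exact ⟨fun h => ⟨h, (mem_cliquesIn.mp h.1).1 h.2⟩, fun h => h.1⟩

theorem packings_zero_one (S : Finset V) : packings H 0 1 S = #(cliquesIn H 2 S) := by
  simp [packings]

theorem packings_zero_two (S : Finset V) :
    packings H 0 2 S + ∑ v ∈ S, #(link H S {v}) ^ 2 =
      #(cliquesIn H 2 S) ^ 2 + #(cliquesIn H 2 S) := by
  rw [← sum_sum_card_link, packings, ← sum_add_distrib]
  calc _ = ∑ B ∈ cliquesIn H 2 S, (#(cliquesIn H 2 S) + 1) := by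
        refine sum_congr rfl fun B hB => ?_
        rw [packings_zero_one, card_cliquesIn_two_sdiff (mem_cliquesIn.mp hB).1,
          card_cliquesIn_self hB]
        simp
    _ = _ := by
        rw [sum_const, smul_eq_mul]
        ring

end Links

section Ramsey

variable {V : Type*} [DecidableEq V]

/-- `H` has neither a clique nor an independent set of four vertices. -/
structure IsRamseyFour (H : SimpleGraph V) : Prop where
  cliquesIn_four (S : Finset V) : cliquesIn H 4 S = ∅
  card_le_three (S : Finset V) : cliquesIn H 2 S = ∅ → #S ≤ 3

variable {H : SimpleGraph V} {S : Finset V}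

theorem cliquesIn_link_eq_empty {j k : ℕ} (hS : cliquesIn H (j + k) S = ∅) {A : Finset V}
    (hA : A ∈ cliquesIn H j S) : cliquesIn H k (link H S A) = ∅ := by
  rw [eq_empty_iff_forall_notMem] at *
  exact fun B hB => hS _ (union_mem_cliquesIn hA hB).1

theorem card_eq_zero_of_cliquesIn_one (h : cliquesIn H 1 S = ∅) : #S = 0 := by
  rw [← card_cliquesIn_one (H := H), h, card_empty]

namespace IsRamseyFour

theorem card_link_le_three (hR : IsRamseyFour H) {B : Finset V} (hB : B ∈ cliquesIn H 2 S) :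
    #(link H S B) ≤ 3 :=
  hR.card_le_three _ (cliquesIn_link_eq_empty (j := 2) (hR.cliquesIn_four S) hB)

theorem cliquesIn_three_link (hR : IsRamseyFour H) {v : V} (hv : v ∈ S) :
    cliquesIn H 3 (link H S {v}) = ∅ :=
  cliquesIn_link_eq_empty (j := 1) (hR.cliquesIn_four S) (singleton_mem_cliquesIn hv)

theorem card_link_singleton_le_three (hR : IsRamseyFour H) (hS : cliquesIn H 3 S = ∅) {v : V}
    (hv : v ∈ S) : #(link H S {v}) ≤ 3 :=
  hR.card_le_three _ (cliquesIn_link_eq_empty (j := 1) hS (singleton_mem_cliquesIn hv))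

theorem sum_card_link_le_of_mem_three (hR : IsRamseyFour H) {B : Finset V}
    (hB : B ∈ cliquesIn H 3 S) : ∑ v ∈ B, #(link H S {v}) ≤ 2 * #S := by
  have h1 := sum_card_link_le (H := H) S B
  have h2 := card_eq_zero_of_cliquesIn_one
    (cliquesIn_link_eq_empty (j := 3) (hR.cliquesIn_four S) hB)
  rw [(mem_cliquesIn.mp hB).2.1] at h1
  omega

end IsRamseyFour

theorem sum_card_link_sq_le (S : Finset V) :
    ∑ v ∈ S, #(link H S {v}) ^ 2 ≤ #(cliquesIn H 2 S) * #S + 3 * #(cliquesIn H 3 S) := by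
  rw [← sum_sum_card_link, ← sum_card_link, ← smul_eq_mul, ← sum_const, ← sum_add_distrib]
  refine sum_le_sum fun B hB => ?_
  have h1 := sum_card_link_le (H := H) S B
  rw [(mem_cliquesIn.mp hB).2.1] at h1
  omega

theorem four_mul_sq_le (S : Finset V) :
    4 * #(cliquesIn H 2 S) ^ 2 ≤ #S * ∑ v ∈ S, #(link H S {v}) ^ 2 := by
  have h := sq_sum_le_card_mul_sum_sq (s := S) (f := fun v => #(link H S {v}))
  rw [sum_card_link_singleton] at h
  linarith

/-- Mantel's theorem. -/
theorem four_mul_card_le_sq (hS : cliquesIn H 3 S = ∅) : 4 * #(cliquesIn H 2 S) ≤ #S ^ 2 := by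
  have h1 := sum_card_link_sq_le (H := H) S
  have h2 := four_mul_sq_le (H := H) S
  rw [hS, card_empty, mul_zero, add_zero] at h1
  rcases Nat.eq_zero_or_pos #(cliquesIn H 2 S) with h | h
  · simp [h]
  · have := Nat.mul_le_mul_left #S h1
    nlinarith

namespace IsRamseyFour

variable (hR : IsRamseyFour H)
include hR

theorem two_mul_card_le (hS : cliquesIn H 3 S = ∅) : 2 * #(cliquesIn H 2 S) ≤ 3 * #S := by
  rw [← sum_card_link_singleton, mul_comm 3, ← smul_eq_mul]
  exact sum_le_card_nsmul _ _ _ fun v hv => hR.card_link_singleton_le_three hS hv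

theorem card_three_le_card_two (S : Finset V) : #(cliquesIn H 3 S) ≤ #(cliquesIn H 2 S) := by
  have h := sum_card_link (H := H) S
  have := sum_le_card_nsmul (cliquesIn H 2 S) (fun B => #(link H S B)) 3
    fun B hB => hR.card_link_le_three hB
  rw [smul_eq_mul] at this
  omega

theorem twelve_mul_card_three_le (S : Finset V) :
    12 * #(cliquesIn H 3 S) ≤ #(cliquesIn H 2 S) * (#S + 3) := by
  have h1 := sum_card_link_sq_le (H := H) S
  have h2 := hR.card_three_le_card_two S
  have h3 : ∑ v ∈ S, 4 * #(cliquesIn H 2 (link H S {v})) ≤ ∑ v ∈ S, #(link H S {v}) ^ 2 :=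
    sum_le_sum fun v hv => four_mul_card_le_sq (hR.cliquesIn_three_link hv)
  rw [← mul_sum, sum_card_cliquesIn_two_link] at h3
  linarith

/-- Turán's theorem for graphs without cliques of size four. -/
theorem three_mul_card_le_sq (S : Finset V) : 3 * #(cliquesIn H 2 S) ≤ #S ^ 2 := by
  induction hs : #S using Nat.strong_induction_on generalizing S with
  | _ s ih =>
    rcases (cliquesIn H 3 S).eq_empty_or_nonempty with h | ⟨T, hT⟩
    · have := four_mul_card_le_sq h
      rw [hs] at this
      omega
    · have h1 := card_cliquesIn_two_sdiff (H := H) (mem_cliquesIn.mp hT).1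
      rw [card_cliquesIn_self hT] at h1
      have h2 := card_sdiff_of_mem_cliquesIn hT
      have h3 := hR.sum_card_link_le_of_mem_three hT
      have h4 := ih _ (by omega) (S \ T) rfl
      rw [show Nat.choose 3 2 = 3 from rfl] at h1
      obtain ⟨r, rfl⟩ : ∃ r, s = r + 3 := ⟨#(S \ T), by omega⟩
      rw [show #(S \ T) = r by omega] at h4
      nlinarith

end IsRamseyFour

theorem card_mul_packings_zero_two_le (h : 4 ≤ #S) :
    #S * packings H 0 2 S ≤
      #(cliquesIn H 2 S) * ((#S - 4) * #(cliquesIn H 2 S) + #S) := by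
  have h1 := packings_zero_two (H := H) S
  have h2 := four_mul_sq_le (H := H) S
  obtain ⟨r, hr⟩ := Nat.exists_eq_add_of_le h
  rw [hr] at h2 ⊢
  have := congrArg (fun x => (4 + r) * x) h1
  simp only [mul_add] at this
  rw [Nat.add_sub_cancel_left]
  linarith

theorem ten_mul_card_le (S : Finset V) :
    10 * #(cliquesIn H 2 S) ≤ ∑ v ∈ S, #(link H S {v}) ^ 2 + 6 * #S := by
  have h : ∑ v ∈ S, 5 * #(link H S {v}) ≤ ∑ v ∈ S, (#(link H S {v}) ^ 2 + 6) := by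
    refine sum_le_sum fun v _ => ?_
    rcases le_or_gt #(link H S {v}) 2 with h | h
    · interval_cases #(link H S {v}) <;> norm_num
    · nlinarith
  rw [← mul_sum, sum_card_link_singleton, sum_add_distrib, sum_const, smul_eq_mul] at h
  linarith

namespace IsRamseyFour

variable (hR : IsRamseyFour H)
include hR

theorem packings_zero_two_le_four (h : #S = 4) : packings H 0 2 S ≤ 4 := by
  have h1 := packings_zero_two (H := H) S
  have h2 := card_mul_packings_zero_two_le (H := H) h.ge
  have h3 := hR.three_mul_card_le_sq S
  have h4 := ten_mul_card_le (H := H) S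
  rw [h] at *
  simp only [Nat.sub_self, zero_mul, zero_add] at h2
  have h5 : #(cliquesIn H 2 S) ≤ 5 := by omega
  rcases h5.lt_or_eq with h5 | h5
  · omega
  · rw [h5] at h1 h4
    omega

end IsRamseyFour

/-- An upper bound for the number of sequences of `p` disjoint edges on `s` vertices. -/
def matchingCap : ℕ → ℕ → ℕ
  | _, 0 => 1
  | s, p + 1 => if s = 4 ∧ p = 1 then 4 else s ^ 2 / 3 * matchingCap (s - 2) p

/-- An upper bound for the number of sequences of `p` disjoint edges on `s` vertices spanning at
most `e` edges. -/
def matchingBound (s e : ℕ) : ℕ → ℕ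
  | 0 => 1
  | 1 => e
  | p + 2 => e * ((s - 4) * e + s) / s * matchingCap (s - 4) p

theorem packings_zero_succ_le {m p : ℕ} (h : ∀ B ∈ cliquesIn H 2 S, packings H 0 p (S \ B) ≤ m) :
    packings H 0 (p + 1) S ≤ #(cliquesIn H 2 S) * m := by
  rw [packings, ← smul_eq_mul]
  exact sum_le_card_nsmul _ _ _ h

theorem packings_succ_le {m t p : ℕ} (h : ∀ B ∈ cliquesIn H 3 S, packings H t p (S \ B) ≤ m) :
    packings H (t + 1) p S ≤ #(cliquesIn H 3 S) * m := by
  rw [packings, ← smul_eq_mul]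
  exact sum_le_card_nsmul _ _ _ h

namespace IsRamseyFour

variable (hR : IsRamseyFour H)
include hR

theorem packings_le_matchingCap (p : ℕ) (S : Finset V) :
    packings H 0 p S ≤ matchingCap #S p := by
  induction p generalizing S with
  | zero => simp [packings, matchingCap]
  | succ p ih =>
    rw [matchingCap]
    split_ifs with h
    · rw [h.2]
      exact hR.packings_zero_two_le_four h.1
    · refine (packings_zero_succ_le fun B hB => ?_).trans (Nat.mul_le_mul_right _ ?_)
      · have := card_sdiff_of_mem_cliquesIn hB
        rw [show #S - 2 = #(S \ B) by omega]
        exact ih _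
      · have := hR.three_mul_card_le_sq S
        omega

theorem packings_le_matchingBound {e : ℕ} (p : ℕ) (h : #(cliquesIn H 2 S) ≤ e) :
    packings H 0 p S ≤ matchingBound #S e p := by
  match p with
  | 0 => simp [packings, matchingBound]
  | 1 => simpa [packings, matchingBound] using h
  | p + 2 =>
    rcases lt_or_ge #S 4 with h4 | h4
    · rw [packings_eq_zero_of_card_lt (by omega)]
      exact Nat.zero_le _
    have h1 : packings H 0 (p + 2) S ≤ packings H 0 2 S * matchingCap (#S - 4) p := by
      simp only [packings, sum_const, smul_eq_mul, mul_one]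
      rw [sum_mul]
      refine sum_le_sum fun B hB => ?_
      rw [← smul_eq_mul]
      refine sum_le_card_nsmul _ _ _ fun C hC => ?_
      have := card_sdiff_of_mem_cliquesIn hB
      have := card_sdiff_of_mem_cliquesIn hC
      rw [show #S - 4 = #((S \ B) \ C) by omega]
      exact hR.packings_le_matchingCap _ _
    refine h1.trans (Nat.mul_le_mul_right _ ?_)
    rw [Nat.le_div_iff_mul_le (by omega), mul_comm]
    refine (card_mul_packings_zero_two_le (H := H) h4).trans ?_
    gcongr

end IsRamseyFour

end Ramsey

section Uncoverable

variable {V : Type*} [DecidableEq V] {H : SimpleGraph V} {S : Finset V}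

theorem not_cliqueCover_sdiff {k m : ℕ} (h : ¬ CliqueCover H S (m + 1)) {B : Finset V}
    (hB : B ∈ cliquesIn H k S) : ¬ CliqueCover H (S \ B) m :=
  fun h' => h (.of_sdiff (mem_cliquesIn.mp hB).2.2 h')

theorem packings_eq_zero_of_not_cliqueCover {t p m : ℕ} (h : ¬ CliqueCover H S m)
    (hm : #S ≤ m + 2 * t + p) : packings H t p S = 0 := by
  by_contra h'
  exact h (.of_packings_ne_zero h' hm)

theorem packings_one_zero (S : Finset V) : packings H 1 0 S = #(cliquesIn H 3 S) := by
  simp [packings]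

/-- A vertex with few non-neighbours can be added to one of the parts of a clique cover. -/
theorem CliqueCover.of_erase {m : ℕ} {w : V} (hw : w ∈ S) (h : CliqueCover H (S.erase w) m)
    (hd : #S < #(link H S {w}) + 1 + m) : CliqueCover H S m := by
  obtain ⟨c, h1, h2⟩ := h
  obtain ⟨i, hi⟩ : (range m \ (S.erase w \ link H S {w}).image c).Nonempty := by
    rw [← card_pos]
    have h3 := le_card_sdiff ((S.erase w \ link H S {w}).image c) (range m)
    have h4 : #((S.erase w \ link H S {w}).image c) ≤ _ := card_image_le
    have h5 : #(S.erase w \ link H S {w}) + #(link H S {w}) = #(S.erase w) := by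
      refine card_sdiff_add_card_eq_card fun v hv => ?_
      rw [mem_link_singleton] at hv
      exact mem_erase.mpr ⟨hv.2.ne', hv.1⟩
    rw [card_erase_of_mem hw] at h5
    rw [card_range] at h3
    have := card_pos.mpr ⟨w, hw⟩
    omega
  simp only [mem_sdiff, mem_range, mem_image, mem_erase, mem_link_singleton, not_exists] at hi
  obtain ⟨him, hi⟩ := hi
  refine ⟨fun v => if v = w then i else c v, fun v hv => ?_, fun u hu v hv huv hadj => ?_⟩
  · dsimp only
    split_ifs with hvw
    · exact him
    · exact h1 v (mem_erase.mpr ⟨hvw, hv⟩)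
  · dsimp only
    split_ifs with huw hvw hvw
    · exact absurd (huw.trans hvw.symm) huv
    · subst huw
      exact fun h => hi v ⟨⟨⟨hvw, hv⟩, fun h => hadj h.2⟩, h.symm⟩
    · subst hvw
      exact fun h => hi u ⟨⟨⟨huw, hu⟩, fun h => hadj h.2.symm⟩, h⟩
    · exact h2 u (mem_erase.mpr ⟨huw, hu⟩) v (mem_erase.mpr ⟨hvw, hv⟩) huv hadj

theorem card_link_of_not_cliqueCover {m : ℕ} (h : ¬ CliqueCover H S m) {w : V} (hw : w ∈ S)
    (h' : CliqueCover H (S.erase w) m) : #(link H S {w}) + 1 + m ≤ #S := by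
  by_contra h''
  exact h (.of_erase hw h' (by omega))

theorem two_mul_card_le_of_forall {d : ℕ} (h : ∀ v ∈ S, #(link H S {v}) ≤ d) :
    2 * #(cliquesIn H 2 S) ≤ #S * d := by
  rw [← sum_card_link_singleton, ← smul_eq_mul]
  exact sum_le_card_nsmul _ _ _ h

theorem card_cliquesIn_two_eq {w : V} (hw : w ∈ S) :
    #(cliquesIn H 2 S) = #(cliquesIn H 2 (S.erase w)) + #(link H S {w}) := by
  have := card_cliquesIn_succ (H := H) 1 hw
  rwa [card_cliquesIn_one] at this

omit [DecidableEq V] in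
theorem card_link_lt {w : V} (hw : w ∈ S) : #(link H S {w}) < #S :=
  card_lt_card ⟨link_subset _, fun h => (mem_link_singleton.mp (h hw)).2.ne rfl⟩

namespace IsRamseyFour

variable (hR : IsRamseyFour H)
include hR

theorem two_mul_card_erase_le {w : V} (hw : w ∈ S) (hd : #(link H S {w}) + 1 = #S) :
    2 * #(cliquesIn H 2 (S.erase w)) ≤ 3 * #(S.erase w) := by
  have : link H S {w} = S.erase w := by
    refine eq_of_subset_of_card_le (fun v hv => ?_) ?_
    · rw [mem_link_singleton] at hv
      exact mem_erase.mpr ⟨hv.2.ne', hv.1⟩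
    · rw [card_erase_of_mem hw]
      omega
  exact hR.two_mul_card_le (this ▸ hR.cliquesIn_three_link hw)

theorem card_le_mul_of_cliqueCover {m : ℕ} (h : CliqueCover H S m) : #S ≤ m * 3 := by
  obtain ⟨c, h1, h2⟩ := h
  have := card_le_mul_card_image_of_maps_to (s := S) (t := range m) (f := c)
    (fun v hv => mem_range.mpr (h1 v hv)) 3 fun i _ => ?_
  · rwa [card_range, mul_comm] at this
  · by_contra! h4
    obtain ⟨B, hB, hcard⟩ := exists_subset_card_eq (Nat.succ_le_of_lt h4)
    have : B ∈ cliquesIn H 4 S := by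
      refine mem_cliquesIn.mpr ⟨hB.trans (filter_subset _ _), hcard, fun u hu v hv huv => ?_⟩
      have hu' := mem_filter.mp (hB hu)
      have hv' := mem_filter.mp (hB hv)
      by_contra hadj
      exact h2 u hu'.1 v hv'.1 huv hadj (hu'.2.trans hv'.2.symm)
    rw [hR.cliquesIn_four] at this
    exact notMem_empty _ this

theorem exists_mem_cliquesIn_two (h : 4 ≤ #S) : ∃ B, B ∈ cliquesIn H 2 S := by
  by_contra! h'
  have := hR.card_le_three S (eq_empty_of_forall_notMem h')
  omega

theorem cliqueCover_three (h : #S ≤ 5) : CliqueCover H S 3 := by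
  by_contra hc
  have h4 : 4 ≤ #S := by
    by_contra h4
    exact hc (.of_card_le (by omega))
  have hdisj : ∀ B ∈ cliquesIn H 2 S, ∀ C ∈ cliquesIn H 2 S, ¬ Disjoint B C := by
    intro B hB C hC hBC
    have hC' : C ∈ cliquesIn H 2 (S \ B) := by
      rw [mem_cliquesIn] at hC ⊢
      exact ⟨subset_sdiff.mpr ⟨hC.1, hBC.symm⟩, hC.2⟩
    have h1 := card_sdiff_of_mem_cliquesIn hB
    have h2 := card_sdiff_of_mem_cliquesIn hC'
    exact not_cliqueCover_sdiff (not_cliqueCover_sdiff hc hB) hC' (.of_card_le (by omega))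
  obtain ⟨B, hB⟩ := hR.exists_mem_cliquesIn_two h4
  obtain ⟨u, hu, v, hv, huv, rfl⟩ := exists_pair_of_mem_cliquesIn hB
  have hS : #S = 5 := by
    by_contra h5
    have h1 := card_sdiff_of_mem_cliquesIn hB
    exact not_cliqueCover_sdiff hc hB (.of_card_le (by omega))
  have key : ∀ u v : V, u ∈ S → v ∈ S → H.Adj u v → ∃ x ∈ S, x ≠ u ∧ H.Adj v x := by
    intro u v hu hv huv
    obtain ⟨C, hC⟩ := hR.exists_mem_cliquesIn_two (S := S.erase u)
      (by rw [card_erase_of_mem hu]; omega)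
    obtain ⟨x, hx, y, hy, hxy, rfl⟩ := exists_pair_of_mem_cliquesIn hC
    rw [mem_erase] at hx hy
    have := hdisj _ (pair_mem_cliquesIn hu hv huv) _ (cliquesIn_mono (erase_subset _ _) hC)
    simp only [disjoint_insert_right, disjoint_singleton_right, mem_insert, mem_singleton,
      not_or, not_and, not_not] at this
    rcases eq_or_ne x v with rfl | hxv
    · exact ⟨y, hy.2, hy.1, hxy⟩
    · obtain rfl := this ⟨hx.1, hxv⟩ hy.1
      exact ⟨x, hx.2, hx.1, hxy.symm⟩
  obtain ⟨x, hx, hxu, hvx⟩ := key u v hu hv huv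
  obtain ⟨y, hy, hyv, huy⟩ := key v u hv hu huv.symm
  have := hdisj _ (pair_mem_cliquesIn hv hx hvx) _ (pair_mem_cliquesIn hu hy huy)
  simp only [disjoint_insert_right, disjoint_singleton_right, mem_insert, mem_singleton,
    not_or, not_and, not_not] at this
  obtain rfl := this ⟨huv.ne, hxu.symm⟩ hyv
  have hT : {u, v, y} ∈ cliquesIn H 3 S := by
    refine mem_cliquesIn.mpr ⟨?_, ?_, ?_⟩
    · simp [insert_subset_iff, hu, hv, hx]
    · rw [card_eq_three]
      exact ⟨u, v, y, huv.ne, huy.ne, hvx.ne, rfl⟩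
    · simp [SimpleGraph.isClique_insert, huv, huy, hvx]
  have h1 := card_sdiff_of_mem_cliquesIn hT
  exact not_cliqueCover_sdiff hc hT (.of_card_le (by omega))

omit hR in
theorem _root_.card_le_three_of_not_cliqueCover_two (hS : #S = 4) (h : ¬ CliqueCover H S 2) :
    #(cliquesIn H 2 S) ≤ 3 := by
  have h1 := packings_eq_zero_of_not_cliqueCover (t := 0) (p := 2) h (by omega)
  have h2 := packings_eq_zero_of_not_cliqueCover (t := 1) (p := 0) h (by omega)
  have h3 := packings_zero_two (H := H) S
  have h4 := sum_card_link_sq_le (H := H) S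
  rw [packings_one_zero] at h2
  rw [h2, hS] at h4
  nlinarith

theorem card_le_of_not_cliqueCover_three_six (hS : #S = 6) (h : ¬ CliqueCover H S 3) :
    #(cliquesIn H 2 S) ≤ 5 := by
  have hd : ∀ v ∈ S, #(link H S {v}) ≤ 2 := by
    intro v hv
    have := card_link_of_not_cliqueCover h hv
      (hR.cliqueCover_three (by rw [card_erase_of_mem hv]; omega))
    omega
  by_contra! h6
  have h6' := two_mul_card_le_of_forall hd
  obtain ⟨B, hB⟩ := hR.exists_mem_cliquesIn_two (S := S) (by omega)
  have h1 := card_cliquesIn_two_sdiff (H := H) (mem_cliquesIn.mp hB).1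
  rw [card_cliquesIn_self hB, Nat.choose_self] at h1
  have h2 := sum_le_card_nsmul B (fun v => #(link H S {v})) 2
    fun v hv => hd v ((mem_cliquesIn.mp hB).1 hv)
  rw [(mem_cliquesIn.mp hB).2.1] at h2
  have hcard := card_sdiff_of_mem_cliquesIn hB
  have hc := not_cliqueCover_sdiff h hB
  have h3 := card_le_three_of_not_cliqueCover_two (by omega) hc
  have h4 := packings_eq_zero_of_not_cliqueCover (t := 0) (p := 2) hc (by omega)
  have h5 := packings_eq_zero_of_not_cliqueCover (t := 1) (p := 0) hc (by omega)
  have h7 := packings_zero_two (H := H) (S \ B)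
  have he : #(cliquesIn H 2 (S \ B)) = 3 := by
    rw [smul_eq_mul] at h2
    omega
  rw [packings_one_zero, card_eq_zero] at h5
  obtain ⟨v, hv, hv0⟩ : ∃ v ∈ S \ B, #(link H (S \ B) {v}) = 0 := by
    by_contra! hne
    have : ∑ v ∈ S \ B, (#(link H (S \ B) {v}) ^ 2 + 2) ≤
        ∑ v ∈ S \ B, 3 * #(link H (S \ B) {v}) := by
      refine sum_le_sum fun v hv => ?_
      have h8 := hne v hv
      have h9 : #(link H (S \ B) {v}) ≤ 2 :=
        (card_le_card (link_mono sdiff_subset _)).trans (hd v (mem_sdiff.mp hv).1)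
      interval_cases #(link H (S \ B) {v}) <;> simp_all
    rw [sum_add_distrib, sum_const, smul_eq_mul, ← mul_sum, sum_card_link_singleton, he] at this
    rw [he, h4] at h7
    omega
  have h8 := card_cliquesIn_two_eq (H := H) hv
  have h9 := four_mul_card_le_sq (H := H) (S := (S \ B).erase v)
    (subset_empty.mp (h5 ▸ cliquesIn_mono (erase_subset _ _)))
  rw [card_erase_of_mem hv, show #(S \ B) = 4 by omega] at h9
  omega

omit hR in
theorem _root_.card_le_of_not_cliqueCover_succ {s d l : ℕ} (hS : #S = s + 1)
    (h : ¬ CliqueCover H S 3)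
    (ih : ∀ S' : Finset V, S' ⊆ S → #S' = s → ¬ CliqueCover H S' 3 → #(cliquesIn H 2 S') ≤ l)
    (hd : ∀ v ∈ S, #(link H S {v}) ≤ d) :
    2 * #(cliquesIn H 2 S) ≤ (s + 1) * (s - 3) ∨ #(cliquesIn H 2 S) ≤ l + d := by
  by_cases hall : ∀ w ∈ S, CliqueCover H (S.erase w) 3
  · left
    rw [← hS]
    refine two_mul_card_le_of_forall fun v hv => ?_
    have := card_link_of_not_cliqueCover h hv (hall v hv)
    omega
  · right
    push Not at hall
    obtain ⟨w, hw, hw'⟩ := hall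
    have h1 := ih _ (erase_subset w S) (by rw [card_erase_of_mem hw]; omega) hw'
    have h2 := hd w hw
    have h3 := card_cliquesIn_two_eq (H := H) hw
    omega

theorem card_le_of_not_cliqueCover_three_seven {d : ℕ} (hS : #S = 7) (h : ¬ CliqueCover H S 3)
    (hd : ∀ v ∈ S, #(link H S {v}) ≤ d) (hd' : 5 ≤ d) : #(cliquesIn H 2 S) ≤ 5 + d := by
  have := card_le_of_not_cliqueCover_succ hS h
    (fun S' _ h1 h2 => hR.card_le_of_not_cliqueCover_three_six h1 h2) hd
  omega

theorem card_le_of_not_cliqueCover_succ' {s l : ℕ} (hS : #S = s + 1)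
    (h : ¬ CliqueCover H S 3)
    (ih : ∀ S' : Finset V, S' ⊆ S → #S' = s → ¬ CliqueCover H S' 3 → #(cliquesIn H 2 S') ≤ l) :
    2 * #(cliquesIn H 2 S) ≤ (s + 1) * (s - 3) ∨ #(cliquesIn H 2 S) ≤ l + (s - 1) ∨
      2 * #(cliquesIn H 2 S) ≤ 5 * s := by
  by_cases hd : ∀ v ∈ S, #(link H S {v}) ≤ s - 1
  · rcases card_le_of_not_cliqueCover_succ hS h ih hd with h | h
    · exact .inl h
    · exact .inr (.inl h)
  · push Not at hd
    obtain ⟨w, hw, hw'⟩ := hd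
    have h1 := card_link_lt (H := H) hw
    have h2 := hR.two_mul_card_erase_le hw (by omega)
    have h3 := card_cliquesIn_two_eq (H := H) hw
    rw [card_erase_of_mem hw] at h2
    omega

theorem card_le_of_not_cliqueCover_three_eight (hS : #S = 8) (h : ¬ CliqueCover H S 3) :
    #(cliquesIn H 2 S) ≤ 17 := by
  have := hR.card_le_of_not_cliqueCover_succ' (l := 11) hS h fun S' _ h1 h2 =>
    hR.card_le_of_not_cliqueCover_three_seven (d := 6) h1 h2
      (fun v hv => by have := card_link_lt (H := H) hv; omega) (by norm_num)
  omega

theorem card_le_of_not_cliqueCover_three_nine (hS : #S = 9) (h : ¬ CliqueCover H S 3) :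
    #(cliquesIn H 2 S) ≤ 24 := by
  have := hR.card_le_of_not_cliqueCover_succ' hS h fun S' _ h1 h2 =>
    hR.card_le_of_not_cliqueCover_three_eight h1 h2
  omega

theorem card_le_of_not_cliqueCover_three_ten (hS : #S = 10) (h : ¬ CliqueCover H S 3) :
    #(cliquesIn H 2 S) ≤ 32 := by
  have := hR.card_le_of_not_cliqueCover_succ' hS h fun S' _ h1 h2 =>
    hR.card_le_of_not_cliqueCover_three_nine h1 h2
  omega

omit hR in
theorem _root_.not_cliqueCover_one_three (hS : #S = 3) (h : ¬ CliqueCover H S 1) :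
    #(cliquesIn H 2 S) ≤ 2 := by
  by_contra! h3
  refine h ⟨fun _ => 0, fun _ _ => one_pos, fun u hu v hv huv hadj => ?_⟩
  have : cliquesIn H 2 S = S.powersetCard 2 := by
    refine eq_of_subset_of_card_le (fun B hB => ?_) (by rw [card_powersetCard, hS]; exact h3)
    rw [mem_cliquesIn] at hB
    exact mem_powersetCard.mpr ⟨hB.1, hB.2.1⟩
  have h4 : {u, v} ∈ cliquesIn H 2 S := by
    rw [this, mem_powersetCard]
    exact ⟨by simp [insert_subset_iff, hu, hv], card_pair huv⟩
  exact absurd ((mem_cliquesIn.mp h4).2.2 (by simp) (by simp) huv) hadj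

theorem card_le_of_not_cliqueCover_two_five (hS : #S = 5) (h : ¬ CliqueCover H S 2) :
    #(cliquesIn H 2 S) ≤ 7 := by
  by_contra! h8
  have h1 := hR.three_mul_card_le_sq S
  rw [hS] at h1
  have h2 := hR.twelve_mul_card_three_le S
  have h3 : ∑ B ∈ cliquesIn H 2 S, 2 ≤ ∑ B ∈ cliquesIn H 2 S, #(link H S B) := by
    refine sum_le_sum fun B hB => ?_
    have h4 := card_sdiff_of_mem_cliquesIn hB
    have h5 := not_cliqueCover_one_three (by omega) (not_cliqueCover_sdiff h hB)
    have h6 := card_cliquesIn_two_sdiff (H := H) (mem_cliquesIn.mp hB).1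
    have h7 := sum_card_link_le (H := H) S B
    rw [card_cliquesIn_self hB, Nat.choose_self] at h6
    rw [(mem_cliquesIn.mp hB).2.1] at h7
    omega
  rw [sum_card_link, sum_const, smul_eq_mul] at h3
  rw [hS, show #(cliquesIn H 2 S) = 8 by omega] at h2
  omega

theorem packings_two_le_of_not_cliqueCover_two_five (hS : #S = 5) (h : ¬ CliqueCover H S 2) :
    packings H 0 2 S ≤ 14 := by
  have h1 := hR.card_le_of_not_cliqueCover_two_five hS h
  have h2 : packings H 0 2 S ≤ #(cliquesIn H 2 S) * 2 := packings_zero_succ_le fun B hB => by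
    have h4 := card_sdiff_of_mem_cliquesIn hB
    rw [packings_zero_one]
    exact not_cliqueCover_one_three (by omega) (not_cliqueCover_sdiff h hB)
  omega

theorem card_le_of_not_cliqueCover_two_six (hS : #S = 6) (h : ¬ CliqueCover H S 2) :
    #(cliquesIn H 2 S) ≤ 11 := by
  by_contra! h12
  rcases (cliquesIn H 3 S).eq_empty_or_nonempty with h3 | ⟨T, hT⟩
  · have := four_mul_card_le_sq h3
    rw [hS] at this
    omega
  · have h1 := card_sdiff_of_mem_cliquesIn hT
    have h2 := not_cliqueCover_one_three (by omega) (not_cliqueCover_sdiff h hT)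
    have h3 := card_cliquesIn_two_sdiff (H := H) (mem_cliquesIn.mp hT).1
    have h4 := hR.sum_card_link_le_of_mem_three hT
    rw [card_cliquesIn_self hT, show Nat.choose 3 2 = 3 from rfl] at h3
    omega

end IsRamseyFour

end Uncoverable

section Critical

variable {V : Type*} [DecidableEq V] {H : SimpleGraph V} {S : Finset V}

/-- `S` cannot be covered by four cliques of `H`, but every proper subset of `S` can. -/
structure IsCoverCritical (H : SimpleGraph V) (S : Finset V) : Prop where
  not_cliqueCover : ¬ CliqueCover H S 4
  cliqueCover_erase : ∀ v ∈ S, CliqueCover H (S.erase v) 4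

namespace IsCoverCritical

variable (hS : IsCoverCritical H S)
include hS

theorem five_le_card : 5 ≤ #S := by
  by_contra h
  exact hS.not_cliqueCover (.of_card_le (by omega))

theorem card_le_thirteen (hR : IsRamseyFour H) : #S ≤ 13 := by
  obtain ⟨v, hv⟩ : S.Nonempty := card_pos.mp (by have := hS.five_le_card; omega)
  have := hR.card_le_mul_of_cliqueCover (hS.cliqueCover_erase v hv)
  rw [card_erase_of_mem hv] at this
  omega

theorem card_link_le : ∀ v ∈ S, #(link H S {v}) ≤ #S - 5 := fun v hv => by
  have := card_link_of_not_cliqueCover hS.not_cliqueCover hv (hS.cliqueCover_erase v hv)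
  omega

theorem two_mul_card_le : 2 * #(cliquesIn H 2 S) ≤ #S * (#S - 5) :=
  two_mul_card_le_of_forall hS.card_link_le

theorem packings_eq_zero {t p : ℕ} (h : #S ≤ 2 * t + p + 4) : packings H t p S = 0 :=
  packings_eq_zero_of_not_cliqueCover hS.not_cliqueCover (by omega)

theorem card_sdiff_le {l : ℕ}
    (hl : ∀ S' ⊆ S, #S' + 3 = #S → ¬ CliqueCover H S' 3 → #(cliquesIn H 2 S') ≤ l)
    (hR : IsRamseyFour H) :
    #(cliquesIn H 2 S) + 3 ≤ l + 3 * (#S - 5) ∨ 2 * #(cliquesIn H 2 S) ≤ 3 * #S := by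
  rcases (cliquesIn H 3 S).eq_empty_or_nonempty with h3 | ⟨T, hT⟩
  · exact .inr (hR.two_mul_card_le h3)
  · left
    have h1 := card_cliquesIn_two_sdiff (H := H) (mem_cliquesIn.mp hT).1
    rw [card_cliquesIn_self hT, show Nat.choose 3 2 = 3 from rfl] at h1
    have h2 := sum_le_card_nsmul T (fun v => #(link H S {v})) _
      fun v hv => hS.card_link_le v ((mem_cliquesIn.mp hT).1 hv)
    rw [(mem_cliquesIn.mp hT).2.1, smul_eq_mul] at h2
    have h3 := hl _ sdiff_subset (card_sdiff_of_mem_cliquesIn hT)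
      (not_cliqueCover_sdiff hS.not_cliqueCover hT)
    omega

theorem card_le_of_card_eq_nine (hR : IsRamseyFour H) (h : #S = 9) :
    #(cliquesIn H 2 S) ≤ 14 := by
  have := hS.card_sdiff_le (fun S' _ h1 h2 =>
    hR.card_le_of_not_cliqueCover_three_six (by omega) h2) hR
  omega

theorem card_sdiff_le_of_card_eq_ten (hR : IsRamseyFour H) (h : #S = 10) {S' : Finset V}
    (hsub : S' ⊆ S) (hcard : #S' = 7) (hc : ¬ CliqueCover H S' 3) :
    #(cliquesIn H 2 S') ≤ 10 :=
  hR.card_le_of_not_cliqueCover_three_seven (d := 5) hcard hc (fun v hv =>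
    (card_le_card (link_mono hsub _)).trans (by simpa [h] using hS.card_link_le v (hsub hv))) le_rfl

theorem card_le_of_card_eq_ten (hR : IsRamseyFour H) (h : #S = 10) :
    #(cliquesIn H 2 S) ≤ 22 := by
  have := hS.card_sdiff_le (fun S' h0 h1 h2 =>
    hS.card_sdiff_le_of_card_eq_ten hR h h0 (by omega) h2) hR
  omega

theorem card_le_of_card_eq_eleven (hR : IsRamseyFour H) (h : #S = 11) :
    #(cliquesIn H 2 S) ≤ 32 := by
  have := hS.card_sdiff_le (fun S' _ h1 h2 =>
    hR.card_le_of_not_cliqueCover_three_eight (by omega) h2) hR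
  omega

theorem card_three_eq_zero (hR : IsRamseyFour H) (h : #S ≤ 8) : #(cliquesIn H 3 S) = 0 := by
  rw [card_eq_zero]
  by_contra h3
  obtain ⟨T, hT⟩ := nonempty_iff_ne_empty.mpr h3
  have := card_sdiff_of_mem_cliquesIn hT
  exact not_cliqueCover_sdiff hS.not_cliqueCover hT (hR.cliqueCover_three (by omega))

theorem card_three_le_of_card_eq_ten (hR : IsRamseyFour H) (h : #S = 10) :
    #(cliquesIn H 3 S) ≤ 17 := by
  have h1 : ∑ v ∈ S, 5 * #(cliquesIn H 2 (link H S {v})) ≤ ∑ v ∈ S, 6 * #(link H S {v}) := by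
    refine sum_le_sum fun v hv => ?_
    have h2 := four_mul_card_le_sq (hR.cliquesIn_three_link hv)
    have h3 := hS.card_link_le v hv
    rw [h] at h3
    interval_cases #(link H S {v}) <;> omega
  rw [← mul_sum, ← mul_sum, sum_card_cliquesIn_two_link, sum_card_link_singleton] at h1
  have := hS.card_le_of_card_eq_ten hR h
  omega

theorem card_three_le_of_card_eq_twelve (hR : IsRamseyFour H) (h : #S = 12) :
    #(cliquesIn H 3 S) ≤ 40 := by
  have h1 : ∑ v ∈ S, #(cliquesIn H 2 (link H S {v})) ≤ ∑ v ∈ S, (#(link H S {v}) + 3) := by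
    refine sum_le_sum fun v hv => ?_
    have h2 := four_mul_card_le_sq (hR.cliquesIn_three_link hv)
    have h3 := hS.card_link_le v hv
    have h4 := hR.two_mul_card_le (hR.cliquesIn_three_link hv)
    rw [h] at h3
    interval_cases #(link H S {v}) <;> omega
  rw [sum_add_distrib, sum_card_cliquesIn_two_link, sum_card_link_singleton, sum_const,
    smul_eq_mul, h] at h1
  have := hS.two_mul_card_le
  rw [h] at this
  omega

theorem packings_three_le_of_card_eq_eight (hR : IsRamseyFour H) (h : #S = 8) :
    packings H 0 3 S ≤ 336 := by
  have h1 := card_mul_packings_zero_two_le (H := H) (S := S) (by omega)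
  have h2 := hS.two_mul_card_le
  rw [h] at h1 h2
  have h3 : packings H 0 2 S ≤ 84 := by
    have : #(cliquesIn H 2 S) ≤ 12 := by omega
    have : #(cliquesIn H 2 S) * ((8 - 4) * #(cliquesIn H 2 S) + 8) ≤ 12 * ((8 - 4) * 12 + 8) := by
      gcongr
    omega
  have h4 : packings H 0 3 S ≤ packings H 0 2 S * 4 := by
    simp only [packings, sum_const, smul_eq_mul, mul_one]
    rw [sum_mul]
    refine sum_le_sum fun B hB => ?_
    rw [← smul_eq_mul]
    refine sum_le_card_nsmul _ _ _ fun C hC => ?_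
    have h5 := card_sdiff_of_mem_cliquesIn hB
    have h6 := card_sdiff_of_mem_cliquesIn hC
    have h7 := four_mul_card_le_sq (H := H) (S := (S \ B) \ C) (subset_empty.mp <|
      (card_eq_zero.mp <| hS.card_three_eq_zero hR h.le) ▸
        cliquesIn_mono (sdiff_subset.trans sdiff_subset))
    rw [show #((S \ B) \ C) = 4 by omega] at h7
    omega
  omega

theorem le_packings_zero_two_of_card_eq_thirteen (h : #S = 13) (he : 49 ≤ #(cliquesIn H 2 S)) :
    1666 ≤ packings H 0 2 S := by
  have h1 : ∑ B ∈ cliquesIn H 2 S, 34 ≤ ∑ B ∈ cliquesIn H 2 S, #(cliquesIn H 2 (S \ B)) := by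
    refine sum_le_sum fun B hB => ?_
    have h1 := card_cliquesIn_two_sdiff (H := H) (mem_cliquesIn.mp hB).1
    rw [card_cliquesIn_self hB, Nat.choose_self] at h1
    have h2 := sum_le_card_nsmul B (fun v => #(link H S {v})) _
      fun v hv => hS.card_link_le v ((mem_cliquesIn.mp hB).1 hv)
    rw [(mem_cliquesIn.mp hB).2.1, smul_eq_mul, h] at h2
    omega
  rw [sum_const, smul_eq_mul] at h1
  have h2 : packings H 0 2 S = ∑ B ∈ cliquesIn H 2 S, #(cliquesIn H 2 (S \ B)) := by
    simp [packings]
  omega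

end IsCoverCritical

end Critical

section PackingBounds

variable {V : Type*} [DecidableEq V] {H : SimpleGraph V} {S : Finset V}

/-- A bound for the number of packings in terms of bounds `τ i` for the number of triangles and
`m i p` for the number of packings of `p` edges after the removal of `i` triangles. -/
def packingBound (τ : ℕ → ℕ) (m : ℕ → ℕ → ℕ) : ℕ → ℕ → ℕ
  | 0, p => m 0 p
  | t + 1, p => τ 0 * packingBound (fun i => τ (i + 1)) (fun i => m (i + 1)) t p

/-- The hypotheses of `packings_le_packingBound`. -/
def PackingBounded (H : SimpleGraph V) (S : Finset V) (τ : ℕ → ℕ) (m : ℕ → ℕ → ℕ) : ℕ → Prop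
  | 0 => ∀ p, packings H 0 p S ≤ m 0 p
  | t + 1 => (∀ p, packings H 0 p S ≤ m 0 p) ∧ #(cliquesIn H 3 S) ≤ τ 0 ∧
      ∀ B ∈ cliquesIn H 3 S, PackingBounded H (S \ B) (fun i => τ (i + 1)) (fun i => m (i + 1)) t

theorem packings_le_packingBound {k : ℕ} {τ : ℕ → ℕ} {m : ℕ → ℕ → ℕ}
    (h : PackingBounded H S τ m k) {t : ℕ} (ht : t ≤ k) (p : ℕ) :
    packings H t p S ≤ packingBound τ m t p := by
  induction t generalizing S τ m k with
  | zero =>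
    cases k with
    | zero => exact h p
    | succ k => exact h.1 p
  | succ t ih =>
    obtain ⟨k, rfl⟩ : ∃ j, k = j + 1 := ⟨k - 1, by omega⟩
    exact (packings_succ_le fun B hB => ih (h.2.2 B hB) (by omega)).trans
      (Nat.mul_le_mul_right _ h.2.1)

end PackingBounds

section NewtonSeries

/-- Evaluation of a polynomial given by its list of coefficients, constant term first. -/
def evalCoeffs (w : ℝ) : List ℤ → ℝ
  | [] => 0
  | c :: cs => c + w * evalCoeffs w cs

/-- The coefficients of `c + p`. -/
def addConstCoeff (c : ℤ) : List ℤ → List ℤ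
  | [] => [c]
  | d :: ds => (c + d) :: ds

/-- The coefficients of `(X + a) * p`. -/
def mulLinear (a : ℤ) : List ℤ → List ℤ
  | [] => []
  | c :: cs => (a * c) :: addConstCoeff c (mulLinear a cs)

/-- The coefficients of `p - r`. -/
def subCoeffs : List ℤ → List ℤ → List ℤ
  | p, [] => p
  | [], d :: ds => (-d) :: subCoeffs [] ds
  | c :: cs, d :: ds => (c - d) :: subCoeffs cs ds

/-- A lower bound for the values of a polynomial on the unit interval. -/
def lowerBound : List ℤ → ℤ
  | [] => 0
  | c :: cs => c + min 0 (lowerBound cs)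

/-- The coefficients of `c * (X + a) ^ n`. -/
def powLinear (c a : ℤ) : ℕ → List ℤ
  | 0 => [c]
  | n + 1 => mulLinear a (powLinear c a n)

/-- The Newton series `c₀ + (z - j) * (c₁ + (z - j - 1) * (c₂ + ⋯))`. -/
def newtonEval (z : ℝ) : ℕ → List ℤ → ℝ
  | _, [] => 0
  | j, c :: cs => c + (z - j) * newtonEval z (j + 1) cs

/-- The coefficients, as a polynomial in `w`, of the Newton series at `z = (m + w) / q`, with
denominators cleared. -/
def newtonCoeffs (q m : ℕ) : ℕ → List ℤ → List ℤ
  | _, [] => []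
  | j, c :: cs =>
    addConstCoeff (c * q ^ (cs.length + 1)) (mulLinear (m - q * j) (newtonCoeffs q m (j + 1) cs))

/-- The choice of lower or upper bounds for the coefficients that maximizes a Newton series on
the interval from `b` to `b + 1`. -/
def extremalCoeffs (b : ℕ) : ℕ → List (ℤ × ℤ) → List ℤ
  | _, [] => []
  | j, p :: ps => (if (j - (b + 1)) % 2 = 0 then p.2 else p.1) :: extremalCoeffs b (j + 1) ps

/-- The coefficients of the difference between `(z + 4) ^ n` and the Newton series at
`z = (m + w) / q`, with denominators cleared. -/
def diffCoeffs (q n b m : ℕ) (ps : List (ℤ × ℤ)) : List ℤ :=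
  subCoeffs (powLinear q (m + 4 * q) n) (newtonCoeffs q m 0 (extremalCoeffs b 0 ps))

theorem evalCoeffs_addConstCoeff (w : ℝ) (c : ℤ) (p : List ℤ) :
    evalCoeffs w (addConstCoeff c p) = c + evalCoeffs w p := by
  cases p with
  | nil => simp [addConstCoeff, evalCoeffs]
  | cons d ds =>
    simp only [addConstCoeff, evalCoeffs]
    push_cast
    ring

theorem evalCoeffs_mulLinear (w : ℝ) (a : ℤ) (p : List ℤ) :
    evalCoeffs w (mulLinear a p) = (w + a) * evalCoeffs w p := by
  induction p with
  | nil => simp [mulLinear, evalCoeffs]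
  | cons c cs ih =>
    simp only [mulLinear, evalCoeffs, evalCoeffs_addConstCoeff, ih]
    push_cast
    ring

theorem evalCoeffs_subCoeffs (w : ℝ) (p r : List ℤ) :
    evalCoeffs w (subCoeffs p r) = evalCoeffs w p - evalCoeffs w r := by
  induction r generalizing p with
  | nil => simp [subCoeffs, evalCoeffs]
  | cons d ds ih =>
    cases p with
    | nil =>
      simp only [subCoeffs, evalCoeffs, ih]
      push_cast
      ring
    | cons c cs =>
      simp only [subCoeffs, evalCoeffs, ih]
      push_cast
      ring

theorem evalCoeffs_powLinear (w : ℝ) (c a : ℤ) (n : ℕ) :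
    evalCoeffs w (powLinear c a n) = c * (w + a) ^ n := by
  induction n with
  | zero => simp [powLinear, evalCoeffs]
  | succ n ih =>
    rw [powLinear, evalCoeffs_mulLinear, ih]
    ring

theorem lowerBound_le_evalCoeffs {w : ℝ} (h0 : 0 ≤ w) (h1 : w ≤ 1) (p : List ℤ) :
    (lowerBound p : ℝ) ≤ evalCoeffs w p := by
  induction p with
  | nil => simp [lowerBound, evalCoeffs]
  | cons c cs ih =>
    simp only [lowerBound, evalCoeffs]
    push_cast
    have h2 := min_le_left (0 : ℝ) (lowerBound cs)
    have h3 := min_le_right (0 : ℝ) (lowerBound cs)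
    nlinarith [mul_nonneg h0 (sub_nonneg.mpr (h3.trans ih)),
      mul_nonneg (sub_nonneg.mpr h1) (sub_nonneg.mpr h2)]

theorem evalCoeffs_nonneg {w : ℝ} (h0 : 0 ≤ w) {p : List ℤ} (hp : ∀ c ∈ p, 0 ≤ c) :
    0 ≤ evalCoeffs w p := by
  induction p with
  | nil => simp [evalCoeffs]
  | cons c cs ih =>
    have h1 : (0 : ℝ) ≤ c := mod_cast hp c (by simp)
    have h2 := ih fun d hd => hp d (by simp [hd])
    simp only [evalCoeffs]
    positivity

theorem evalCoeffs_newtonCoeffs {q m : ℕ} {w z : ℝ} (h : q * z = w + m) (j : ℕ) (cs : List ℤ) :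
    evalCoeffs w (newtonCoeffs q m j cs) = q ^ cs.length * newtonEval z j cs := by
  induction cs generalizing j with
  | nil => simp [newtonCoeffs, evalCoeffs, newtonEval]
  | cons c cs ih =>
    simp only [newtonCoeffs, newtonEval, evalCoeffs_addConstCoeff, evalCoeffs_mulLinear, ih,
      List.length_cons]
    push_cast
    linear_combination -(q : ℝ) ^ cs.length * newtonEval z (j + 1) cs * h

theorem length_extremalCoeffs (b j : ℕ) (ps : List (ℤ × ℤ)) :
    (extremalCoeffs b j ps).length = ps.length := by
  induction ps generalizing j with
  | nil => rfl
  | cons p ps ih => simp [extremalCoeffs, ih]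

theorem neg_one_pow_mul_descPochhammer_nonneg {z : ℝ} {b L j : ℕ} (hz : (b : ℝ) ≤ z)
    (hz' : ∀ i, b < i → i < L → z ≤ i) (hj : j ≤ L) :
    0 ≤ (-1) ^ (j - (b + 1)) * (descPochhammer ℝ j).eval z := by
  induction j with
  | zero => simp
  | succ j ih =>
    have h := ih (by omega)
    rw [descPochhammer_succ_eval]
    rcases le_or_gt j b with hjb | hjb
    · rw [Nat.sub_eq_zero_of_le (by omega)] at h ⊢
      have : (j : ℝ) ≤ b := mod_cast hjb
      rw [pow_zero, one_mul] at h ⊢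
      exact mul_nonneg h (by linarith)
    · have := hz' j hjb (by omega)
      rw [show j + 1 - (b + 1) = j - (b + 1) + 1 by omega, pow_succ]
      nlinarith [mul_nonneg h (sub_nonneg.mpr this)]

theorem sum_le_newtonEval {z : ℝ} {b L : ℕ} (hz : (b : ℝ) ≤ z)
    (hz' : ∀ i, b < i → i < L → z ≤ i) {a : ℕ → ℝ} {ps : List (ℤ × ℤ)} {j : ℕ}
    (hL : j + ps.length ≤ L + 1)
    (ha : ∀ i p, ps[i]? = some p → (p.1 : ℝ) ≤ a (j + i) ∧ a (j + i) ≤ p.2) :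
    ∑ i ∈ range ps.length, a (j + i) * (descPochhammer ℝ (j + i)).eval z ≤
      (descPochhammer ℝ j).eval z * newtonEval z j (extremalCoeffs b j ps) := by
  induction ps generalizing j with
  | nil => simp [newtonEval, extremalCoeffs]
  | cons p ps ih =>
    rw [List.length_cons] at hL ⊢
    have h1 := ih (j := j + 1) (by omega) fun i p' hp' => by
      rw [add_assoc, add_comm 1]
      exact ha (i + 1) p' (by simpa using hp')
    have h2 := neg_one_pow_mul_descPochhammer_nonneg hz hz' (show j ≤ L by omega)
    have h3 := ha 0 p (by simp)
    rw [add_zero] at h3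
    rw [sum_range_succ', add_zero, extremalCoeffs, newtonEval]
    simp only [← add_assoc]
    simp only [add_right_comm j 1] at h1
    rw [descPochhammer_succ_eval] at h1
    have h4 : a j * (descPochhammer ℝ j).eval z ≤ (descPochhammer ℝ j).eval z *
        ((if (j - (b + 1)) % 2 = 0 then p.2 else p.1 : ℤ) : ℝ) := by
      split_ifs with hpar
      · rw [(Nat.even_iff.mpr hpar).neg_one_pow, one_mul] at h2
        nlinarith
      · rw [(Nat.odd_iff.mpr (by omega)).neg_one_pow] at h2
        nlinarith
    linarith

theorem sum_le_pow_of_evalCoeffs_nonneg {q n b m : ℕ} {w z : ℝ} (hq : 0 < q)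
    (h : q * z = w + m) (hz : (b : ℝ) ≤ z) (hz' : ∀ i, b < i → i < n → z ≤ i) {a : ℕ → ℝ}
    {ps : List (ℤ × ℤ)} (hn : ps.length = n + 1)
    (ha : ∀ i p, ps[i]? = some p → (p.1 : ℝ) ≤ a i ∧ a i ≤ p.2)
    (hnonneg : 0 ≤ evalCoeffs w (diffCoeffs q n b m ps)) :
    ∑ j ∈ range (n + 1), a j * (descPochhammer ℝ j).eval z ≤ (z + 4) ^ n := by
  have h1 := sum_le_newtonEval (j := 0) (ps := ps) (a := a) hz hz' (by omega) (by simpa using ha)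
  simp only [zero_add, descPochhammer_zero, Polynomial.eval_one, one_mul, hn] at h1
  refine h1.trans ?_
  rw [diffCoeffs, evalCoeffs_subCoeffs, evalCoeffs_powLinear, evalCoeffs_newtonCoeffs h,
    length_extremalCoeffs, hn] at hnonneg
  push_cast at hnonneg
  rw [← add_assoc, ← h, show (q * z + 4 * q : ℝ) = q * (z + 4) by ring, mul_pow] at hnonneg
  have h2 : (0 : ℝ) < q ^ (n + 1) := by positivity
  refine le_of_mul_le_mul_left ?_ h2
  rw [pow_succ] at hnonneg ⊢
  linarith

/-- A decidable criterion for `sum_le_pow`. -/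
def DiffNonneg (q n : ℕ) (ps : List (ℤ × ℤ)) : Prop :=
  (∀ m < q * n, 0 ≤ lowerBound (diffCoeffs q n (m / q) m ps)) ∧
    ∀ c ∈ diffCoeffs q n n (q * n) ps, 0 ≤ c

instance (q n : ℕ) (ps : List (ℤ × ℤ)) : Decidable (DiffNonneg q n ps) :=
  inferInstanceAs (Decidable (_ ∧ _))

theorem sum_le_pow {q n : ℕ} (hq : 0 < q) {ps : List (ℤ × ℤ)} (hn : ps.length = n + 1)
    (hps : DiffNonneg q n ps) {a : ℕ → ℝ}
    (ha : ∀ i p, ps[i]? = some p → (p.1 : ℝ) ≤ a i ∧ a i ≤ p.2) {z : ℝ} (hz : 0 ≤ z) :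
    ∑ j ∈ range (n + 1), a j * (descPochhammer ℝ j).eval z ≤ (z + 4) ^ n := by
  have hq' : (0 : ℝ) < q := mod_cast hq
  rcases lt_or_ge z n with hzn | hzn
  · have hqz : 0 ≤ q * z := by positivity
    have hfloor := Nat.floor_le hqz
    have hfloor' := Nat.lt_floor_add_one (q * z)
    have hm : ⌊q * z⌋₊ < q * n := by
      rw [Nat.floor_lt hqz]
      push_cast
      gcongr
    have hdiv : (((⌊q * z⌋₊ / q : ℕ) : ℝ)) * q ≤ ⌊q * z⌋₊ := mod_cast Nat.div_mul_le_self _ _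
    refine sum_le_pow_of_evalCoeffs_nonneg hq (w := q * z - ⌊q * z⌋₊) (m := ⌊q * z⌋₊)
      (b := ⌊q * z⌋₊ / q) (by ring) ?_ ?_ hn ha ?_
    · nlinarith
    · intro i hi _
      rw [Nat.div_lt_iff_lt_mul hq] at hi
      have : ((⌊q * z⌋₊ : ℝ)) + 1 ≤ i * q := mod_cast hi
      nlinarith
    · refine le_trans ?_ (lowerBound_le_evalCoeffs (by linarith) (by linarith) _)
      exact_mod_cast hps.1 _ hm
  · refine sum_le_pow_of_evalCoeffs_nonneg hq (w := q * z - q * n) (m := q * n) (b := n)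
      (by push_cast; ring) hzn (fun i h1 h2 => absurd h1 (by omega)) hn ha
      (evalCoeffs_nonneg ?_ hps.2)
    nlinarith

end NewtonSeries

section PackingCoeff

variable {V : Type*} [DecidableEq V] {H : SimpleGraph V} {S : Finset V}

/-- The number of ways to choose disjoint triangles and edges of `H` in `S` such that contracting
them lowers the number of vertices by `i`. -/
noncomputable def packingCoeff (H : SimpleGraph V) (S : Finset V) (i : ℕ) : ℝ :=
  ∑ t ∈ range (i / 2 + 1),
    (packings H t (i - 2 * t) S : ℝ) / (t.factorial * (i - 2 * t).factorial)

theorem packingCoeff_nonneg (i : ℕ) : 0 ≤ packingCoeff H S i :=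
  sum_nonneg fun _ _ => by positivity

theorem packings_zero_le_packingCoeff (i : ℕ) :
    (packings H 0 i S : ℝ) / i.factorial ≤ packingCoeff H S i := by
  have h := single_le_sum (s := range (i / 2 + 1))
    (f := fun t => (packings H t (i - 2 * t) S : ℝ) / (t.factorial * (i - 2 * t).factorial))
    (fun _ _ => by positivity) (mem_range.mpr (Nat.succ_pos _))
  simpa [packingCoeff] using h

theorem factorial_mul_packingCoeff (i : ℕ) :
    i.factorial * packingCoeff H S i = ∑ t ∈ range (i / 2 + 1),
      ((packings H t (i - 2 * t) S * (i.choose (2 * t) * (2 * t).descFactorial t) : ℕ) : ℝ) := by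
  rw [packingCoeff, mul_sum]
  refine sum_congr rfl fun t ht => ?_
  have h1 := Nat.choose_mul_factorial_mul_factorial
    (show 2 * t ≤ i by have := mem_range.mp ht; omega)
  have h2 := Nat.factorial_mul_descFactorial (show t ≤ 2 * t by omega)
  rw [show 2 * t - t = t by omega] at h2
  rw [← h1, ← h2]
  have := Nat.factorial_ne_zero t
  have := Nat.factorial_ne_zero (i - 2 * t)
  push_cast
  field_simp

/-- A decidable criterion bounding the numbers `packingCoeff H S (n - j)` by the upper bounds listed
in `ps`. -/
def CoeffsBounded (τ : ℕ → ℕ) (m : ℕ → ℕ → ℕ) (n : ℕ) (ps : List (ℤ × ℤ)) : Prop :=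
  ∀ j < n + 1, ((∑ t ∈ range ((n - j) / 2 + 1), packingBound τ m t (n - j - 2 * t) *
    ((n - j).choose (2 * t) * (2 * t).descFactorial t) : ℕ) : ℤ) ≤
      (n - j).factorial * (ps.getD j 0).2

instance (τ : ℕ → ℕ) (m : ℕ → ℕ → ℕ) (n : ℕ) (ps : List (ℤ × ℤ)) :
    Decidable (CoeffsBounded τ m n ps) :=
  inferInstanceAs (Decidable (∀ j < n + 1, _))

theorem packingCoeff_le {τ : ℕ → ℕ} {m : ℕ → ℕ → ℕ} {k n : ℕ} {ps : List (ℤ × ℤ)}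
    (h : PackingBounded H S τ m k) (hk : n ≤ 2 * k + 1) (hb : CoeffsBounded τ m n ps)
    {j : ℕ} (hj : j < n + 1) :
    packingCoeff H S (n - j) ≤ (ps.getD j 0).2 := by
  have hpos : (0 : ℝ) < (n - j).factorial := by positivity
  refine le_of_mul_le_mul_left ?_ hpos
  rw [factorial_mul_packingCoeff]
  have h1 : ((∑ t ∈ range ((n - j) / 2 + 1), packingBound τ m t (n - j - 2 * t) *
      ((n - j).choose (2 * t) * (2 * t).descFactorial t) : ℕ) : ℝ) ≤
        (n - j).factorial * (ps.getD j 0).2 := mod_cast hb j hj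
  refine le_trans ?_ h1
  rw [Nat.cast_sum]
  refine sum_le_sum fun t ht => Nat.cast_le.mpr (Nat.mul_le_mul_right _ ?_)
  exact packings_le_packingBound h (by have := mem_range.mp ht; omega) _

/-- The numbers `packingCoeff H S (n - j)` satisfy bounds that suffice for `sum_le_pow`. -/
def HasGoodCoeffs (H : SimpleGraph V) (S : Finset V) (n : ℕ) : Prop :=
  ∃ ps : List (ℤ × ℤ), ps.length = n + 1 ∧ DiffNonneg 16 n ps ∧ ∀ i p, ps[i]? = some p →
    (p.1 : ℝ) ≤ packingCoeff H S (n - i) ∧ packingCoeff H S (n - i) ≤ p.2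

theorem HasGoodCoeffs.of_bounds {τ : ℕ → ℕ} {m : ℕ → ℕ → ℕ} {k n : ℕ} {ps : List (ℤ × ℤ)}
    (h : PackingBounded H S τ m k) (hk : n ≤ 2 * k + 1) (hn : ps.length = n + 1)
    (hps : DiffNonneg 16 n ps) (hb : CoeffsBounded τ m n ps)
    (hl : ∀ i p, ps[i]? = some p → (p.1 : ℝ) ≤ packingCoeff H S (n - i)) :
    HasGoodCoeffs H S n := by
  refine ⟨ps, hn, hps, fun i p hp => ⟨hl i p hp, ?_⟩⟩
  have hi : i < ps.length := by
    by_contra hi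
    rw [List.getElem?_eq_none (not_lt.mp hi)] at hp
    exact absurd hp (by simp)
  have h1 := packingCoeff_le h hk hb (j := i) (by omega)
  rwa [List.getD_eq_getElem?_getD, hp] at h1

theorem HasGoodCoeffs.of_upper_bounds {τ : ℕ → ℕ} {m : ℕ → ℕ → ℕ} {k n : ℕ} (us : List ℤ)
    (h : PackingBounded H S τ m k) (hk : n ≤ 2 * k + 1) (hn : us.length = n + 1)
    (hps : DiffNonneg 16 n (us.map fun u => (0, u)))
    (hb : CoeffsBounded τ m n (us.map fun u => (0, u))) :
    HasGoodCoeffs H S n := by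
  refine .of_bounds h hk (by simpa using hn) hps hb fun i p hp => ?_
  rw [List.getElem?_map, Option.map_eq_some_iff] at hp
  obtain ⟨u, -, rfl⟩ := hp
  simpa using packingCoeff_nonneg _

end PackingCoeff

section Evaluation

variable {V : Type} [Fintype V] [DecidableEq V] {G : SimpleGraph V}

theorem eval_eq_sum_packingCoeff (hH : Gᶜ.CliqueFree 4) (hS : IsCoverCritical Gᶜ univ)
    {P : Polynomial ℝ} (hP : ∀ x : ℕ, P.eval (x : ℝ) = numColorings G x) (r : ℝ) :
    P.eval r = ∑ i ∈ range (Fintype.card V - 5 + 1),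
      packingCoeff Gᶜ univ i * (descPochhammer ℝ (Fintype.card V - i)).eval r := by
  have hcard := hS.five_le_card
  rw [card_univ] at hcard
  rw [eval_eq_sum_packings G hH P hP (Fintype.card V + 1) (by omega), ← sum_product']
  simp only [packingCoeff, sum_mul]
  rw [sum_sigma']
  symm
  refine sum_bij_ne_zero (fun x _ _ => (x.2, x.1 - 2 * x.2)) ?_ ?_ ?_ ?_
  · rintro ⟨i, t⟩ hx -
    simp only [mem_sigma, mem_range, mem_product] at hx ⊢
    omega
  · rintro ⟨i, t⟩ hx - ⟨i', t'⟩ hx' - h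
    simp only [mem_sigma, mem_range, Prod.mk.injEq] at hx hx' h
    obtain ⟨rfl, h⟩ := h
    obtain rfl : i = i' := by omega
    rfl
  · rintro ⟨t, p⟩ - h
    have hle : ¬ Fintype.card V ≤ 2 * t + p + 4 := fun hle => h (by
      simp [hS.packings_eq_zero (by rwa [card_univ])])
    have hmem : (⟨2 * t + p, t⟩ : Σ _ : ℕ, ℕ) ∈
        (range (Fintype.card V - 5 + 1)).sigma fun i => range (i / 2 + 1) := by
      simp only [mem_sigma, mem_range]
      omega
    refine ⟨⟨2 * t + p, t⟩, hmem, ?_, by simp⟩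
    simpa [Nat.sub_sub] using h
  · rintro ⟨i, t⟩ hx -
    simp only [mem_sigma, mem_range] at hx
    rw [show Fintype.card V - i = Fintype.card V - 2 * t - (i - 2 * t) by omega]

theorem eval_le_of_hasGoodCoeffs (hH : Gᶜ.CliqueFree 4) (hS : IsCoverCritical Gᶜ univ)
    (hgood : HasGoodCoeffs Gᶜ univ (Fintype.card V - 5))
    {P : Polynomial ℝ} (hP : ∀ x : ℕ, P.eval (x : ℝ) = numColorings G x) {y : ℝ} (hy : 4 ≤ y) :
    P.eval (y + 1) ≤
      (y + 1) * y ^ (Fintype.card V - 4) * (y - 1) * (y - 2) * (y - 3) := by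
  obtain ⟨ps, hn, hps, hb⟩ := hgood
  have hcard := hS.five_le_card
  rw [card_univ] at hcard
  have hsum := sum_le_pow (by norm_num) hn hps hb (sub_nonneg.mpr hy)
  rw [sub_add_cancel] at hsum
  rw [eval_eq_sum_packingCoeff hH hS hP, ← sum_range_reflect]
  have hfac (j : ℕ) : (descPochhammer ℝ (5 + j)).eval (y + 1) =
      (y + 1) * y * (y - 1) * (y - 2) * (y - 3) * (descPochhammer ℝ j).eval (y - 4) := by
    rw [← descPochhammer_mul, Polynomial.eval_mul, Polynomial.eval_comp,
      descPochhammer_eval_eq_prod_range]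
    simp only [prod_range_succ, prod_range_zero, Polynomial.eval_sub, Polynomial.eval_X]
    norm_num
    rw [show y + 1 - 5 = y - 4 by ring]
    ring
  have hpos : 0 ≤ (y + 1) * y * (y - 1) * (y - 2) * (y - 3) := by
    have : 0 ≤ y - 1 := by linarith
    have : 0 ≤ y - 2 := by linarith
    have : 0 ≤ y - 3 := by linarith
    positivity
  refine le_trans (le_of_eq ?_) ((mul_le_mul_of_nonneg_left hsum hpos).trans (le_of_eq ?_))
  · rw [mul_sum]
    refine sum_congr rfl fun j hj => ?_
    have := mem_range.mp hj
    rw [show Fintype.card V - 5 + 1 - 1 - j = Fintype.card V - 5 - j by omega,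
      show Fintype.card V - (Fintype.card V - 5 - j) = 5 + j by omega, hfac]
    ring
  · rw [show Fintype.card V - 4 = Fintype.card V - 5 + 1 by omega, pow_succ]
    ring

end Evaluation

section GoodCoeffs

variable {V : Type*} [DecidableEq V] {H : SimpleGraph V} {S : Finset V}

theorem IsRamseyFour.packings_le_of_card_eq (hR : IsRamseyFour H) {s e : ℕ} (hs : #S = s)
    (he : #(cliquesIn H 2 S) ≤ e) (p : ℕ) : packings H 0 p S ≤ matchingBound s e p :=
  hs ▸ hR.packings_le_matchingBound p he

theorem IsRamseyFour.packings_le_cap_of_card_eq (hR : IsRamseyFour H) {s : ℕ} (hs : #S = s)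
    (p : ℕ) : packings H 0 p S ≤ matchingCap s p :=
  hs ▸ hR.packings_le_matchingCap p S

namespace IsCoverCritical

variable (hS : IsCoverCritical H S) (hR : IsRamseyFour H)
include hS hR

theorem packingBounded_of_card_le_eight (h : #S ≤ 8) {m : ℕ → ℕ}
    (hm : ∀ p, packings H 0 p S ≤ m p) :
    PackingBounded H S (fun _ => 0) (fun _ => m) 1 := by
  have h3 := hS.card_three_eq_zero hR h
  refine ⟨hm, h3.le, fun B hB => ?_⟩
  rw [card_eq_zero.mp h3] at hB
  exact absurd hB (notMem_empty B)

theorem hasGoodCoeffs_five (h : #S = 5) : HasGoodCoeffs H S 0 := by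
  have h2 := hS.two_mul_card_le
  rw [h] at h2
  exact .of_upper_bounds [1] (hS.packingBounded_of_card_le_eight hR (by omega)
    (hR.packings_le_of_card_eq (e := 0) h (by omega))) (by norm_num) rfl
    (by decide +kernel) (by decide +kernel)

theorem hasGoodCoeffs_six (h : #S = 6) : HasGoodCoeffs H S 1 := by
  have h2 := hS.two_mul_card_le
  rw [h] at h2
  exact .of_upper_bounds [3, 1] (hS.packingBounded_of_card_le_eight hR (by omega)
    (hR.packings_le_of_card_eq (e := 3) h (by omega))) (by norm_num) rfl
    (by decide +kernel) (by decide +kernel)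

theorem hasGoodCoeffs_seven (h : #S = 7) : HasGoodCoeffs H S 2 := by
  have h2 := hS.two_mul_card_le
  rw [h] at h2
  exact .of_upper_bounds [14, 7, 1] (hS.packingBounded_of_card_le_eight hR (by omega)
    (hR.packings_le_of_card_eq (e := 7) h (by omega))) (by norm_num) rfl
    (by decide +kernel) (by decide +kernel)

theorem hasGoodCoeffs_eight (h : #S = 8) : HasGoodCoeffs H S 3 := by
  have h2 := hS.two_mul_card_le
  rw [h] at h2
  refine .of_upper_bounds [56, 42, 12, 1] (hS.packingBounded_of_card_le_eight hR (by omega)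
    (m := fun p => if p = 3 then 336 else matchingBound 8 12 p) fun p => ?_) (by norm_num) rfl
    (by decide +kernel) (by decide +kernel)
  split_ifs with hp
  · exact hp ▸ hS.packings_three_le_of_card_eq_eight hR h
  · exact hR.packings_le_of_card_eq h (by omega) p

theorem hasGoodCoeffs_nine (h : #S = 9) : HasGoodCoeffs H S 4 := by
  refine .of_upper_bounds (k := 2) (τ := fun i => [14, 3].getD i 0)
    (m := fun i => [matchingBound 9 14, matchingBound 6 5, matchingBound 3 3].getD i 0)
    [234, 233, 75, 14, 1] ?_ (by norm_num) rfl (by decide +kernel) (by decide +kernel)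
  have h2 := hS.card_le_of_card_eq_nine hR h
  refine ⟨hR.packings_le_of_card_eq h h2, (hR.card_three_le_card_two S).trans h2, fun B hB => ?_⟩
  have h4 := not_cliqueCover_sdiff hS.not_cliqueCover hB
  have h5 := card_sdiff_of_mem_cliquesIn hB
  have h6 : #(S \ B) = 6 := by omega
  have h7 := hR.card_le_of_not_cliqueCover_three_six h6 h4
  have h8 := hR.twelve_mul_card_three_le (S \ B)
  rw [h6] at h8
  refine ⟨hR.packings_le_of_card_eq h6 h7,
    show #(cliquesIn H 3 (S \ B)) ≤ 3 by omega, fun C hC => ?_⟩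
  have h9 := card_sdiff_of_mem_cliquesIn hC
  have h10 := hR.three_mul_card_le_sq ((S \ B) \ C)
  rw [show #((S \ B) \ C) = 3 by omega] at h10
  exact hR.packings_le_of_card_eq (by omega) (by omega)

theorem hasGoodCoeffs_ten (h : #S = 10) : HasGoodCoeffs H S 5 := by
  refine .of_upper_bounds (k := 2) (τ := fun i => [17, 8].getD i 0)
    (m := fun i => [matchingBound 10 22, matchingBound 7 10, matchingBound 4 3].getD i 0)
    [771, 1290, 794, 173, 22, 1] ?_ (by norm_num) rfl (by decide +kernel) (by decide +kernel)
  refine ⟨hR.packings_le_of_card_eq h (hS.card_le_of_card_eq_ten hR h),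
    hS.card_three_le_of_card_eq_ten hR h, fun B hB => ?_⟩
  have h4 := not_cliqueCover_sdiff hS.not_cliqueCover hB
  have h5 := card_sdiff_of_mem_cliquesIn hB
  have h6 : #(S \ B) = 7 := by omega
  have h7 := hS.card_sdiff_le_of_card_eq_ten hR h sdiff_subset h6 h4
  have h8 := hR.twelve_mul_card_three_le (S \ B)
  rw [h6] at h8
  refine ⟨hR.packings_le_of_card_eq h6 h7,
    show #(cliquesIn H 3 (S \ B)) ≤ 8 by omega, fun C hC => ?_⟩
  have h9 := card_sdiff_of_mem_cliquesIn hC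
  have h10 : #((S \ B) \ C) = 4 := by omega
  exact hR.packings_le_of_card_eq h10
    (card_le_three_of_not_cliqueCover_two h10 (not_cliqueCover_sdiff h4 hC))

theorem hasGoodCoeffs_eleven (h : #S = 11) : HasGoodCoeffs H S 6 := by
  refine .of_upper_bounds (k := 3) (τ := fun i => [32, 15, 4].getD i 0)
    (m := fun i => [matchingBound 11 32, matchingBound 8 17,
      fun p => if p = 2 then 14 else matchingBound 5 7 p, matchingCap 2].getD i 0)
    [2859, 8159, 6459, 2366, 374, 32, 1] ?_ (by norm_num) rfl
    (by decide +kernel) (by decide +kernel)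
  have h2 := hS.card_le_of_card_eq_eleven hR h
  refine ⟨hR.packings_le_of_card_eq h h2, (hR.card_three_le_card_two S).trans h2, fun B hB => ?_⟩
  have h4 := not_cliqueCover_sdiff hS.not_cliqueCover hB
  have h5 := card_sdiff_of_mem_cliquesIn hB
  have h6 : #(S \ B) = 8 := by omega
  have h7 := hR.card_le_of_not_cliqueCover_three_eight h6 h4
  have h8 := hR.twelve_mul_card_three_le (S \ B)
  rw [h6] at h8
  refine ⟨hR.packings_le_of_card_eq h6 h7,
    show #(cliquesIn H 3 (S \ B)) ≤ 15 by omega, fun C hC => ?_⟩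
  have h9 := card_sdiff_of_mem_cliquesIn hC
  have h10 : #((S \ B) \ C) = 5 := by omega
  have h11 := not_cliqueCover_sdiff h4 hC
  have h12 := hR.card_le_of_not_cliqueCover_two_five h10 h11
  have h13 := hR.twelve_mul_card_three_le ((S \ B) \ C)
  rw [h10] at h13
  refine ⟨fun p => ?_, show #(cliquesIn H 3 ((S \ B) \ C)) ≤ 4 by omega, fun D hD p => ?_⟩
  · change _ ≤ if p = 2 then 14 else matchingBound 5 7 p
    split_ifs with hp
    · exact hp ▸ hR.packings_two_le_of_not_cliqueCover_two_five h10 h11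
    · exact hR.packings_le_of_card_eq h10 h12 p
  · have h14 := card_sdiff_of_mem_cliquesIn hD
    have h15 : #(((S \ B) \ C) \ D) = 2 := by omega
    exact hR.packings_le_cap_of_card_eq h15 p

theorem hasGoodCoeffs_twelve (h : #S = 12) : HasGoodCoeffs H S 7 := by
  refine .of_upper_bounds (k := 3) (τ := fun i => [40, 24, 8].getD i 0)
    (m := fun i => [matchingBound 12 42, matchingBound 9 24, matchingBound 6 11,
      matchingCap 3].getD i 0)
    [7920, 28986, 36416, 20149, 5223, 649, 42, 1] ?_ (by norm_num) rfl
    (by decide +kernel) (by decide +kernel)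
  have h2 := hS.two_mul_card_le
  rw [h] at h2
  refine ⟨hR.packings_le_of_card_eq h (by omega),
    hS.card_three_le_of_card_eq_twelve hR h, fun B hB => ?_⟩
  have h4 := not_cliqueCover_sdiff hS.not_cliqueCover hB
  have h5 := card_sdiff_of_mem_cliquesIn hB
  have h6 : #(S \ B) = 9 := by omega
  have h7 := hR.card_le_of_not_cliqueCover_three_nine h6 h4
  have h8 := hR.twelve_mul_card_three_le (S \ B)
  rw [h6] at h8
  refine ⟨hR.packings_le_of_card_eq h6 h7,
    show #(cliquesIn H 3 (S \ B)) ≤ 24 by omega, fun C hC => ?_⟩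
  have h9 := card_sdiff_of_mem_cliquesIn hC
  have h10 : #((S \ B) \ C) = 6 := by omega
  have h12 := hR.card_le_of_not_cliqueCover_two_six h10 (not_cliqueCover_sdiff h4 hC)
  have h13 := hR.twelve_mul_card_three_le ((S \ B) \ C)
  rw [h10] at h13
  refine ⟨hR.packings_le_of_card_eq h10 h12,
    show #(cliquesIn H 3 ((S \ B) \ C)) ≤ 8 by omega, fun D hD p => ?_⟩
  have h14 := card_sdiff_of_mem_cliquesIn hD
  have h15 : #(((S \ B) \ C) \ D) = 3 := by omega
  exact hR.packings_le_cap_of_card_eq h15 p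

theorem packingBounded_of_card_eq_thirteen (h : #S = 13) {e : ℕ} (he : #(cliquesIn H 2 S) ≤ e) :
    PackingBounded H S (fun i => [e, 32, 13, 2].getD i 0)
      (fun i => [matchingBound 13 e, matchingBound 10 32, matchingBound 7 16, matchingCap 4,
        matchingCap 1].getD i 0) 4 := by
  refine ⟨hR.packings_le_of_card_eq h he, (hR.card_three_le_card_two S).trans he, fun B hB => ?_⟩
  have h4 := not_cliqueCover_sdiff hS.not_cliqueCover hB
  have h5 := card_sdiff_of_mem_cliquesIn hB
  have h6 : #(S \ B) = 10 := by omega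
  have h7 := hR.card_le_of_not_cliqueCover_three_ten h6 h4
  refine ⟨hR.packings_le_of_card_eq h6 h7,
    (hR.card_three_le_card_two _).trans h7, fun C hC => ?_⟩
  have h9 := card_sdiff_of_mem_cliquesIn hC
  have h10 : #((S \ B) \ C) = 7 := by omega
  have h12 := hR.three_mul_card_le_sq ((S \ B) \ C)
  have h13 := hR.twelve_mul_card_three_le ((S \ B) \ C)
  rw [h10] at h12 h13
  refine ⟨hR.packings_le_of_card_eq h10 (by omega),
    show #(cliquesIn H 3 ((S \ B) \ C)) ≤ 13 by omega, fun D hD => ?_⟩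
  have h14 := card_sdiff_of_mem_cliquesIn hD
  have h15 : #(((S \ B) \ C) \ D) = 4 := by omega
  have h16 := hR.three_mul_card_le_sq (((S \ B) \ C) \ D)
  have h17 := hR.twelve_mul_card_three_le (((S \ B) \ C) \ D)
  rw [h15] at h16 h17
  refine ⟨hR.packings_le_cap_of_card_eq h15,
    show #(cliquesIn H 3 (((S \ B) \ C) \ D)) ≤ 2 by omega, fun E hE p => ?_⟩
  have h18 := card_sdiff_of_mem_cliquesIn hE
  have h19 : #((((S \ B) \ C) \ D) \ E) = 1 := by omega
  exact hR.packings_le_cap_of_card_eq h19 p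

theorem hasGoodCoeffs_thirteen (h : #S = 13) : HasGoodCoeffs H S 8 := by
  rcases le_or_gt #(cliquesIn H 2 S) 48 with he | he
  · exact .of_upper_bounds [8320, 77044, 152508, 121623, 45846, 8930, 870, 48, 1]
      (hS.packingBounded_of_card_eq_thirteen hR h he) (by norm_num) rfl
      (by decide +kernel) (by decide +kernel)
  · have h2 := hS.two_mul_card_le
    rw [h] at h2
    have h3 : (833 : ℝ) ≤ packingCoeff H S 2 := by
      have h4 : (1666 : ℝ) ≤ packings H 0 2 S :=
        mod_cast hS.le_packings_zero_two_of_card_eq_thirteen h he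
      have h5 := packings_zero_le_packingCoeff (H := H) (S := S) 2
      norm_num at h5
      linarith
    refine .of_bounds (ps := [(0, 9014), (0, 83464), (0, 167291), (0, 135908), (0, 52260),
      (0, 10322), (833, 1014), (0, 52), (0, 1)])
      (hS.packingBounded_of_card_eq_thirteen hR h (e := 52) (by omega)) (by norm_num) rfl
      (by decide +kernel) (by decide +kernel) fun i p hp => ?_
    have hi : i < 9 := by
      by_contra hi
      rw [List.getElem?_eq_none (not_lt.mp hi)] at hp
      exact absurd hp (by simp)
    have hnonneg := packingCoeff_nonneg (H := H) (S := S) (8 - i)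
    interval_cases i <;> obtain rfl := Option.some.inj hp <;> simp_all

theorem hasGoodCoeffs : HasGoodCoeffs H S (#S - 5) := by
  have h1 := hS.five_le_card
  have h2 := hS.card_le_thirteen hR
  obtain h | h | h | h | h | h | h | h | h : #S = 5 ∨ #S = 6 ∨ #S = 7 ∨ #S = 8 ∨ #S = 9 ∨
      #S = 10 ∨ #S = 11 ∨ #S = 12 ∨ #S = 13 := by omega
  all_goals rw [h]
  exacts [hS.hasGoodCoeffs_five hR h, hS.hasGoodCoeffs_six hR h, hS.hasGoodCoeffs_seven hR h,
    hS.hasGoodCoeffs_eight hR h, hS.hasGoodCoeffs_nine hR h, hS.hasGoodCoeffs_ten hR h,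
    hS.hasGoodCoeffs_eleven hR h, hS.hasGoodCoeffs_twelve hR h, hS.hasGoodCoeffs_thirteen hR h]

end IsCoverCritical

end GoodCoeffs

section FiveCritical

variable {V : Type} [DecidableEq V] {G : SimpleGraph V}

theorem cliqueCover_compl_iff {S : Finset V} {m : ℕ} :
    CliqueCover Gᶜ S m ↔ (G.induce (S : Set V)).Colorable m := by
  constructor
  · rintro ⟨c, hc, hne⟩
    exact ⟨.mk (fun v => ⟨c v, hc v v.2⟩) fun {u v} h heq =>
      hne u u.2 v v.2 (fun h' => h.ne (Subtype.ext h')) (fun h' => h'.2 h) (Fin.mk.inj heq)⟩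
  · rintro ⟨c⟩
    refine ⟨fun v => if hv : v ∈ S then c ⟨v, hv⟩ else 0, fun v hv => by simp [hv],
      fun u hu v hv huv h heq => ?_⟩
    have hadj : G.Adj u v := by
      by_contra h'
      exact h ⟨huv, h'⟩
    simp only [hu, hv, dif_pos] at heq
    exact c.valid (v := ⟨u, hu⟩) (w := ⟨v, hv⟩) hadj (Fin.ext heq)

theorem FiveCritical.isCoverCritical [Fintype V] (h : FiveCritical G) :
    IsCoverCritical Gᶜ univ := by
  refine ⟨fun hc => ?_, fun v _ => cliqueCover_compl_iff.mpr ?_⟩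
  · obtain ⟨c, hc, hne⟩ := hc
    have hcol : G.Colorable 4 := ⟨.mk (fun v => ⟨c v, hc v (mem_univ v)⟩) fun {u v} huv heq =>
      hne u (mem_univ u) v (mem_univ v) huv.ne (fun h' => h'.2 huv) (Fin.mk.inj heq)⟩
    have := hcol.chromaticNumber_le
    rw [h.1] at this
    exact absurd this (by norm_num)
  · have hset : ((univ.erase v : Finset V) : Set V) = {u | u ≠ v} := by
      ext u
      simp
    rw [hset]
    exact SimpleGraph.chromaticNumber_le_iff_colorable.mp (h.2 v).le

theorem isRamseyFour_compl (hclique : ¬ ∃ s : Finset V, G.IsNClique 4 s)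
    (hH : Gᶜ.CliqueFree 4) : IsRamseyFour Gᶜ where
  cliquesIn_four S := by
    rw [eq_empty_iff_forall_notMem]
    intro B hB
    rw [mem_cliquesIn] at hB
    exact hH B ⟨hB.2.2, hB.2.1⟩
  card_le_three S hS := by
    by_contra! h
    obtain ⟨T, hTS, hT⟩ := exists_subset_card_eq (show 4 ≤ #S by omega)
    refine hclique ⟨T, fun u hu v hv huv => ?_, hT⟩
    by_contra hadj
    have := pair_mem_cliquesIn (H := Gᶜ) (hTS hu) (hTS hv) ⟨huv, hadj⟩
    rw [hS] at this
    exact absurd this (notMem_empty _)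

end FiveCritical

end Auxiliary

/-- If `G` is a `5`-critical graph on `n` vertices with no clique of size `4` and no
independent set of size `4`, then for every real `y ≥ 4` the chromatic polynomial
(the polynomial `P` interpolating the colouring-counting function) satisfies
`Q_G(y) = P(y+1) ≤ (y+1)·y^(n-4)·(y-1)·(y-2)·(y-3)`. -/
theorem five_critical_ramsey_bound {V : Type} [Fintype V] (G : SimpleGraph V)
    (hcrit : FiveCritical G)
    (hclique : ¬ ∃ s : Finset V, G.IsNClique 4 s)
    (hindep : ¬ ∃ s : Finset V, s.card = 4 ∧
      ∀ a ∈ s, ∀ b ∈ s, a ≠ b → ¬ G.Adj a b)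
    (P : Polynomial ℝ) (hP : ∀ x : ℕ, P.eval (x : ℝ) = numColorings G x) :
    ∀ y : ℝ, 4 ≤ y → P.eval (y + 1) ≤
      (y + 1) * y ^ (Fintype.card V - 4) * (y - 1) * (y - 2) * (y - 3) := by
  classical
  intro y hy
  have hH : Gᶜ.CliqueFree 4 := fun s hs =>
    hindep ⟨s, hs.card_eq, fun a ha b hb hab => (hs.isClique ha hb hab).2⟩
  have hS := hcrit.isCoverCritical
  exact eval_le_of_hasGoodCoeffs hH hS
    (by simpa using hS.hasGoodCoeffs (isRamseyFour_compl hclique hH)) hP hy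
end

section
/- Let G be a 5-critical graph (χ(G) = 5 and χ(G − v) = 4 for every vertex v) that contains no clique of size 4 and no independent set of size 4. Then G has at most 13 vertices. -/
/-- A finite graph with an `n`-colouring whose independent sets have at most `k` vertices has at
most `k * n` vertices. -/
theorem SimpleGraph.Colorable.card_le_mul_of_card_le {W : Type*} [Fintype W] {H : SimpleGraph W}
    {n k : ℕ} (hH : H.Colorable n)
    (hk : ∀ s : Finset W, (∀ a ∈ s, ∀ b ∈ s, a ≠ b → ¬ H.Adj a b) → s.card ≤ k) :
    Fintype.card W ≤ k * n := by
  classical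
  obtain ⟨c⟩ := hH
  have h := Finset.card_le_mul_card_image_of_maps_to (s := Finset.univ) (t := Finset.univ)
    (f := c) (fun _ _ => Finset.mem_univ _) k fun i _ => hk _ fun a ha b hb _ hab => by
      simp only [Finset.mem_filter, Finset.mem_univ, true_and] at ha hb
      exact c.valid hab (ha.trans hb.symm)
  simpa using h

/-- A `5`-critical graph with no clique of size `4` and no independent set of size `4`
has at most `13` vertices. -/
theorem five_critical_ramsey_order {V : Type} [Fintype V] (G : SimpleGraph V)
    (hcrit : FiveCritical G)
    (hclique : ¬ ∃ s : Finset V, G.IsNClique 4 s)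
    (hindep : ¬ ∃ s : Finset V, s.card = 4 ∧
      ∀ a ∈ s, ∀ b ∈ s, a ≠ b → ¬ G.Adj a b) :
    Fintype.card V ≤ 13 := by
  classical
  rcases isEmpty_or_nonempty V with hV | ⟨⟨v⟩⟩
  · simp
  have hcol : (G.induce {u : V | u ≠ v}).Colorable 4 :=
    SimpleGraph.chromaticNumber_le_iff_colorable.mp (hcrit.2 v).le
  have h := hcol.card_le_mul_of_card_le (k := 3) fun s hs => by
    by_contra! hlt
    obtain ⟨t, hts, ht⟩ := Finset.exists_subset_card_eq (Nat.succ_le_of_lt hlt)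
    refine hindep ⟨t.map (Function.Embedding.subtype _), by simpa using ht, ?_⟩
    intro a ha b hb hne hab
    obtain ⟨x, hx, rfl⟩ := Finset.mem_map.mp ha
    obtain ⟨y, hy, rfl⟩ := Finset.mem_map.mp hb
    exact hs x (hts hx) y (hts hy) (fun hxy => hne (congrArg _ hxy)) hab
  have hcard : Fintype.card {u : V | u ≠ v} = Fintype.card V - 1 :=
    Set.card_ne_eq v
  omega
end

section
/- Every connected graph G on n vertices with chromatic number exactly 4 has at most 4!·3^{n-4} proper colourings with 4 colours, where a colouring uses labelled colours (so permuting colours gives different colourings). -/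
open Finset

/-- Choosing the values of a function one index after another, each uniformly from a set that
depends only on the earlier values, defines a sub-probability measure on functions. -/
theorem sum_prod_ite_inv_card_le_one {k : ℕ} (m : ℕ)
    (A : Fin m → (Fin m → Fin k) → Finset (Fin k))
    (hA : ∀ i φ ψ, (∀ j < i, φ j = ψ j) → A i φ = A i ψ) :
    ∑ φ : Fin m → Fin k, ∏ i, (if φ i ∈ A i φ then ((#(A i φ) : ℝ))⁻¹ else 0) ≤ 1 := by
  induction m with
  | zero => simp
  | succ m ih =>
    rw [← (Fin.consEquiv (fun _ : Fin (m + 1) => Fin k)).sum_comp, Fintype.sum_prod_type]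
    have hzero : ∀ φ ψ, A 0 φ = A 0 ψ := fun φ ψ => hA 0 φ ψ (by simp)
    by_cases hk : Nonempty (Fin (m + 1) → Fin k)
    swap
    · have : IsEmpty (Fin k) := by
        refine ⟨fun c => hk ⟨fun _ => c⟩⟩
      simp
    obtain ⟨φ₀⟩ := hk
    calc
      _ ≤ ∑ c : Fin k, (if c ∈ A 0 φ₀ then ((#(A 0 φ₀) : ℝ))⁻¹ else 0) := by
        refine sum_le_sum fun c _ => ?_
        simp only [Fin.prod_univ_succ, Fin.consEquiv, Equiv.coe_fn_mk, Fin.cons_zero, Fin.cons_succ]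
        have := ih (fun i ψ => A i.succ (Fin.cons c ψ)) (by
          intro i φ ψ h
          apply hA
          intro j hj
          induction j using Fin.cases with
          | zero => simp
          | succ j => simpa using h j (by simpa using hj))
        simp only [hzero _ φ₀, ← mul_sum]
        refine mul_le_of_le_one_right ?_ this
        split_ifs <;> positivity
      _ ≤ 1 := by
        rw [← sum_filter, sum_const, filter_mem_eq_inter, univ_inter, nsmul_eq_mul]
        exact mul_inv_le_one

/-- Summing a function of the rank over a finite subset of a linear order. -/
theorem sum_rank_eq_sum_range {α : Type*} [LinearOrder α] (g : ℕ → ℝ) (P : Finset α) :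
    ∑ p ∈ P, g (#{q ∈ P | q < p}) = ∑ j ∈ range (#P), g j := by
  induction P using Finset.induction_on_max with
  | empty => simp
  | insert a s ha ih =>
    have has : a ∉ s := fun h => lt_irrefl _ (ha a h)
    rw [sum_insert has, card_insert_of_notMem has, sum_range_succ, add_comm, ← ih]
    congr 1
    · refine sum_congr rfl fun p hp => ?_
      rw [filter_insert, if_neg (ha p hp).not_gt]
    · rw [filter_insert, if_neg (lt_irrefl a), filter_true_of_mem ha]

/-- In a uniformly random ordering, the rank of an element within a finite set containing it is
uniformly distributed. -/
theorem card_mul_sum_rank {V : Type*} [Fintype V] [DecidableEq V] {n : ℕ} (g : ℕ → ℝ)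
    (T : Finset V) {v : V} (hv : v ∈ T) :
    #T * ∑ σ : V ≃ Fin n, g (#{s ∈ T | σ s < σ v}) =
      Fintype.card (V ≃ Fin n) * ∑ j ∈ range (#T), g j := by
  have key : ∀ t ∈ T, ∑ σ : V ≃ Fin n, g (#{s ∈ T | σ s < σ t}) =
      ∑ σ : V ≃ Fin n, g (#{s ∈ T | σ s < σ v}) := by
    intro t ht
    have hT : ∀ s, Equiv.swap v t s ∈ T ↔ s ∈ T := by
      intro s
      by_cases h1 : s = v
      · subst h1; simp [hv, ht]
      by_cases h2 : s = t
      · subst h2; simp [hv, ht]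
      rw [Equiv.swap_apply_of_ne_of_ne h1 h2]
    rw [← (Equiv.equivCongr (Equiv.swap v t) (Equiv.refl (Fin n))).sum_comp]
    refine sum_congr rfl fun σ _ => ?_
    congr 1
    refine card_bij' (fun s _ => Equiv.swap v t s) (fun s _ => Equiv.swap v t s) ?_ ?_ ?_ ?_
    · intro s hs
      simp only [mem_filter, hT] at hs ⊢
      simpa using hs
    · intro s hs
      simp only [mem_filter, hT] at hs ⊢
      simpa using hs
    · simp
    · simp
  have h := sum_congr rfl key
  rw [sum_const, nsmul_eq_mul] at h
  rw [← h, sum_comm, ← nsmul_eq_mul (Fintype.card _), ← card_univ, ← sum_const]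
  refine sum_congr rfl fun σ _ => ?_
  have := sum_rank_eq_sum_range g (T.map σ.toEmbedding)
  rw [card_map] at this
  rw [← this, sum_map]
  refine sum_congr rfl fun t _ => ?_
  rw [filter_map, card_map]
  rfl

section Colourings

variable {V : Type} [Fintype V] [DecidableEq V] (G : SimpleGraph V) [DecidableRel G.Adj]

/-- The proper colourings of `G` with four colours. -/
def properColorings : Finset (V → Fin 4) := {φ | ∀ u v, G.Adj u v → φ u ≠ φ v}

variable {G} in
theorem mem_properColorings {φ : V → Fin 4} :
    φ ∈ properColorings G ↔ ∀ u v, G.Adj u v → φ u ≠ φ v := by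
  simp [properColorings]

theorem numColorings_eq_card : numColorings G 4 = #(properColorings G) := by
  rw [numColorings, properColorings, Nat.card_eq_fintype_card, Fintype.card_subtype]

/-- The colours that `φ` does not use on the neighbours of `v` preceding `v` in the order `σ`. -/
def available {n : ℕ} (σ : V ≃ Fin n) (φ : V → Fin 4) (v : V) : Finset (Fin 4) :=
  {c | ∀ u, G.Adj u v → σ u < σ v → φ u ≠ c}

variable {G} in
theorem card_available_pos {n : ℕ} (σ : V ≃ Fin n) {φ : V → Fin 4} (hφ : φ ∈ properColorings G)
    (v : V) : 0 < #(available G σ φ v) :=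
  card_pos.2 ⟨φ v, by
    simpa [available] using fun u hu _ => mem_properColorings.1 hφ u v hu⟩

theorem sum_prod_inv_card_available_le_one {n : ℕ} (σ : V ≃ Fin n) :
    ∑ φ ∈ properColorings G, ∏ v, ((#(available G σ φ v) : ℝ))⁻¹ ≤ 1 := by
  refine le_trans ?_ (sum_prod_ite_inv_card_le_one n
    (fun i ψ => available G σ (ψ ∘ σ) (σ.symm i)) ?_)
  · rw [← (Equiv.arrowCongr σ (Equiv.refl (Fin 4))).sum_comp]
    calc
      _ ≤ ∑ φ ∈ properColorings G, ∏ v,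
          (if φ v ∈ available G σ φ v then ((#(available G σ φ v) : ℝ))⁻¹ else 0) := by
        refine sum_le_sum fun φ hφ => le_of_eq (prod_congr rfl fun v _ => ?_)
        rw [if_pos]
        simpa [available] using fun u hu _ => mem_properColorings.1 hφ u v hu
      _ ≤ ∑ φ, ∏ v,
          (if φ v ∈ available G σ φ v then ((#(available G σ φ v) : ℝ))⁻¹ else 0) := by
        refine sum_le_sum_of_subset_of_nonneg (subset_univ _) fun φ _ _ => prod_nonneg fun v _ => ?_
        split_ifs <;> positivity
      _ = _ := by
        refine sum_congr rfl fun φ _ => ?_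
        rw [← σ.symm.prod_comp]
        refine prod_congr rfl fun i _ => ?_
        have : (Equiv.arrowCongr σ (Equiv.refl (Fin 4))) φ ∘ σ = φ := by
          ext x; simp
        rw [this]
        simp
  · intro i φ ψ h
    ext c
    simp only [available, mem_filter, mem_univ, true_and, Function.comp_apply,
      Equiv.apply_symm_apply]
    refine forall_congr' fun u => forall_congr' fun _ => forall_congr' fun hu => ?_
    rw [h _ hu]

/-- An entropy bound: the logarithm of the number of colourings is at most the average, over all
colourings and orders, of the sum of the logarithms of the numbers of available colours. -/
theorem card_mul_log_card_le {n : ℕ} (hP : 0 < #(properColorings G)) :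
    Fintype.card (V ≃ Fin n) * (#(properColorings G) * Real.log #(properColorings G)) ≤
      ∑ σ : V ≃ Fin n, ∑ φ ∈ properColorings G, ∑ v, Real.log #(available G σ φ v) := by
  rw [← nsmul_eq_mul, ← card_univ, ← sum_const]
  refine sum_le_sum fun σ _ => ?_
  set P : ℝ := ((#(properColorings G) : ℕ) : ℝ) with hPdef
  have hP' : 0 < P := Nat.cast_pos.2 hP
  have h1 : ∀ φ ∈ properColorings G, Real.log P - ∑ v, Real.log #(available G σ φ v) ≤
      P * ∏ v, ((#(available G σ φ v) : ℝ))⁻¹ - 1 := by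
    intro φ hφ
    have hne : ∀ v, (#(available G σ φ v) : ℝ) ≠ 0 := fun v => by
      exact_mod_cast (card_available_pos σ hφ v).ne'
    have hprod : 0 < ∏ v, ((#(available G σ φ v) : ℝ))⁻¹ :=
      prod_pos fun v _ => inv_pos.2 (by exact_mod_cast card_available_pos σ hφ v)
    have := Real.log_le_sub_one_of_pos (mul_pos hP' hprod)
    rwa [Real.log_mul hP'.ne' hprod.ne', prod_inv_distrib, Real.log_inv,
      Real.log_prod fun v _ => hne v, ← sub_eq_add_neg, ← prod_inv_distrib] at this
  have h2 := sum_le_sum h1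
  rw [sum_sub_distrib, sum_sub_distrib, ← mul_sum, sum_const, sum_const, nsmul_eq_mul,
    nsmul_eq_mul, ← hPdef] at h2
  have h3 := mul_le_mul_of_nonneg_left (sum_prod_inv_card_available_le_one G σ) hP'.le
  linarith

variable {G} in
/-- Averaging over all orders when some neighbours of `v` have distinct colours. -/
theorem card_mul_sum_log_available_le {n : ℕ} {φ : V → Fin 4} (hφ : φ ∈ properColorings G) {v : V}
    {S : Finset V} (hS : ∀ s ∈ S, G.Adj s v) (hinj : Set.InjOn φ S) :
    ((#S + 1 : ℕ) : ℝ) * ∑ σ : V ≃ Fin n, Real.log #(available G σ φ v) ≤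
      Fintype.card (V ≃ Fin n) * ∑ j ∈ range (#S + 1), Real.log ((4 - j : ℕ) : ℝ) := by
  have hv : v ∉ S := fun h => G.loopless.irrefl _ (hS v h)
  rw [← card_insert_of_notMem hv, ← card_mul_sum_rank _ (insert v S) (mem_insert_self v S)]
  refine mul_le_mul_of_nonneg_left (sum_le_sum fun σ _ => ?_) (Nat.cast_nonneg _)
  refine Real.log_le_log (by exact_mod_cast card_available_pos σ hφ v) ?_
  rw [filter_insert, if_neg (lt_irrefl _)]
  norm_cast
  have hsub : available G σ φ v ⊆ (image φ {s ∈ S | σ s < σ v})ᶜ := by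
    intro c hc
    simp only [available, mem_filter, mem_univ, true_and, mem_compl, mem_image, not_exists,
      not_and] at hc ⊢
    exact fun s hs => hc s (hS s hs.1) hs.2
  refine (card_le_card hsub).trans ?_
  rw [card_compl, card_image_of_injOn (hinj.mono fun x hx => (mem_filter.1 hx).1), Fintype.card_fin]

variable {G} in
/-- Averaging over all orders when `v` has at least three neighbours. -/
theorem four_mul_sum_log_available_le {n : ℕ} {φ : V → Fin 4} (hφ : φ ∈ properColorings G) {v : V}
    {S : Finset V} (hS : ∀ s ∈ S, G.Adj s v) (hcard : #S = 3) :
    4 * ∑ σ : V ≃ Fin n, Real.log #(available G σ φ v) ≤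
      Fintype.card (V ≃ Fin n) * (2 * Real.log 2 + 3 * Real.log 3) := by
  have hv : v ∉ S := fun h => G.loopless.irrefl _ (hS v h)
  have hT : #(insert v S) = 4 := by rw [card_insert_of_notMem hv, hcard]
  have h := card_mul_sum_rank (n := n) (fun j => if j = 0 then Real.log 4 else Real.log 3)
    (insert v S) (mem_insert_self v S)
  rw [hT] at h
  have h4 : Real.log 4 = 2 * Real.log 2 := by
    rw [show (4 : ℝ) = 2 ^ 2 by norm_num, Real.log_pow, Nat.cast_ofNat]
  have h5 : ∑ j ∈ range 4, (if j = 0 then Real.log 4 else Real.log 3) =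
      2 * Real.log 2 + 3 * Real.log 3 := by
    simp [sum_range_succ, h4]; ring
  rw [h5] at h
  rw [← h, Nat.cast_ofNat]
  refine mul_le_mul_of_nonneg_left (sum_le_sum fun σ _ => ?_) (by norm_num)
  have hpos : (0 : ℝ) < #(available G σ φ v) := by exact_mod_cast card_available_pos σ hφ v
  rw [filter_insert, if_neg (lt_irrefl _)]
  split_ifs with h0
  · refine Real.log_le_log hpos ?_
    exact_mod_cast card_le_univ (available G σ φ v)
  · refine Real.log_le_log hpos ?_
    obtain ⟨s, hs⟩ := card_pos.1 (Nat.pos_of_ne_zero h0)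
    rw [mem_filter] at hs
    have hsub : available G σ φ v ⊆ {φ s}ᶜ := by
      intro c hc
      simp only [available, mem_filter, mem_univ, true_and, mem_compl, mem_singleton] at hc ⊢
      exact (hc s (hS s hs.1) hs.2).symm
    have := card_le_card hsub
    rw [card_compl, card_singleton, Fintype.card_fin] at this
    exact_mod_cast this

variable {G} in
/-- The bound on the number of colourings, provided that few colourings are constant on the
chosen neighbours of a vertex, and every colouring has four vertices that see all other colours. -/
theorem mul_card_properColorings_le (N : V → Finset V) (hN : ∀ v, ∀ s ∈ N v, G.Adj s v)
    (hN3 : ∀ v, #(N v) = 3)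
    (hB : ∀ φ ∈ properColorings G, ∃ B : Finset V, #B = 4 ∧
      ∀ v ∈ B, ∃ S : Finset V, (∀ s ∈ S, G.Adj s v) ∧ Set.InjOn φ S ∧ #S = 3)
    (hE : (5 * Real.log 3 - 6 * Real.log 2) *
        ((∑ v, #{φ ∈ properColorings G | ∀ s ∈ N v, ∀ t ∈ N v, φ s = φ t} : ℕ) : ℝ) ≤
      4 * (2 * Real.log 3 - 3 * Real.log 2) * (Fintype.card V - 4) * #(properColorings G)) :
    27 * #(properColorings G) ≤ 8 * 3 ^ Fintype.card V := by
  obtain h0 | hP := Nat.eq_zero_or_pos #(properColorings G)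
  · simp [h0]
  have hent := card_mul_log_card_le G (n := Fintype.card V) hP
  set m := Fintype.card V with hm
  set K : ℝ := (Fintype.card (V ≃ Fin m) : ℝ) with hKdef
  have hK : 0 < K := by
    have : Nonempty (V ≃ Fin m) := ⟨Fintype.equivFin V⟩
    exact Nat.cast_pos.2 Fintype.card_pos
  set a := Real.log 2
  set b := Real.log 3
  have ha : 0 < a := Real.log_pos (by norm_num)
  have hb : 0 < b := Real.log_pos (by norm_num)
  have hab : 0 < 5 * b - 6 * a := by
    have : Real.log ((2 : ℝ) ^ 6) < Real.log ((3 : ℝ) ^ 5) :=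
      Real.log_lt_log (by norm_num) (by norm_num)
    rw [Real.log_pow, Real.log_pow] at this
    push_cast at this
    linarith
  have h4 : Real.log 4 = 2 * a := by
    rw [show (4 : ℝ) = 2 ^ 2 by norm_num, Real.log_pow, Nat.cast_ofNat]
  have hpoint : ∀ φ ∈ properColorings G,
      12 * ∑ v, ∑ σ : V ≃ Fin m, Real.log #(available G σ φ v) ≤
        K * (4 * (3 * a + b) * m - 4 * (3 * a + b) + (5 * b - 6 * a) *
          ∑ v, if ∀ s ∈ N v, ∀ t ∈ N v, φ s = φ t then 1 else 0) := by
    intro φ hφ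
    obtain ⟨B, hB4, hB⟩ := hB φ hφ
    have hv : ∀ v, 12 * ∑ σ : V ≃ Fin m, Real.log #(available G σ φ v) ≤
        K * (4 * (3 * a + b) - (3 * a + b) * (if v ∈ B then 1 else 0) + (5 * b - 6 * a) *
          (if ∀ s ∈ N v, ∀ t ∈ N v, φ s = φ t then 1 else 0)) := by
      intro v
      by_cases hvB : v ∈ B
      · obtain ⟨S, hS, hinj, hS3⟩ := hB v hvB
        have h := card_mul_sum_log_available_le (n := m) hφ hS hinj
        rw [hS3] at h
        norm_num [sum_range_succ, h4] at h
        have : 0 ≤ K * ((5 * b - 6 * a) *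
          (if ∀ s ∈ N v, ∀ t ∈ N v, φ s = φ t then (1 : ℝ) else 0)) := by
          split_ifs <;> nlinarith
        rw [if_pos hvB]
        linarith
      rw [if_neg hvB]
      by_cases hmono : ∀ s ∈ N v, ∀ t ∈ N v, φ s = φ t
      · rw [if_pos hmono]
        have h := four_mul_sum_log_available_le (n := m) hφ (hN v) (hN3 v)
        linarith
      · rw [if_neg hmono]
        push Not at hmono
        obtain ⟨s, hs, t, ht, hst⟩ := hmono
        have hne : s ≠ t := fun h => hst (h ▸ rfl)
        have h := card_mul_sum_log_available_le (n := m) (v := v) (S := {s, t}) hφ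
          (by simpa using ⟨hN v s hs, hN v t ht⟩) (by simp [Set.InjOn, hst, Ne.symm hst])
        rw [card_pair hne] at h
        norm_num [sum_range_succ, h4] at h
        linarith
    have hsum := sum_le_sum fun v (_ : v ∈ univ) => hv v
    rw [← mul_sum, ← mul_sum, sum_add_distrib, sum_sub_distrib, ← mul_sum, ← mul_sum, sum_const,
      card_univ, ← hm, nsmul_eq_mul, sum_boole, filter_mem_eq_inter, univ_inter, hB4, ← mul_sum] at hsum
    push_cast at hsum
    linarith
  have hswap : ∑ φ ∈ properColorings G, ∑ v,
      (if ∀ s ∈ N v, ∀ t ∈ N v, φ s = φ t then (1 : ℝ) else 0) =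
      ((∑ v, #{φ ∈ properColorings G | ∀ s ∈ N v, ∀ t ∈ N v, φ s = φ t} : ℕ) : ℝ) := by
    rw [sum_comm]
    push_cast
    exact sum_congr rfl fun v _ => sum_boole _ _
  have htot := sum_le_sum hpoint
  rw [← mul_sum, ← mul_sum, sum_add_distrib, ← mul_sum, sum_const, nsmul_eq_mul, hswap] at htot
  rw [sum_comm] at hent
  simp only [sum_comm (s := (univ : Finset (V ≃ Fin m))) (t := (univ : Finset V))] at hent
  set P : ℝ := ((#(properColorings G) : ℕ) : ℝ) with hPdef
  have hP' : 0 < P := Nat.cast_pos.2 hP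
  have h1 : K * (12 * (P * Real.log P)) ≤ K * (12 * (P * (b * m + 3 * a - 3 * b))) := by
    have h2 := mul_le_mul_of_nonneg_left hE hK.le
    linarith
  have h2 := le_of_mul_le_mul_left h1 hK
  have h3 : Real.log P ≤ b * m + 3 * a - 3 * b :=
    le_of_mul_le_mul_left (le_of_mul_le_mul_left h2 (by norm_num)) hP'
  have h5 : Real.log (27 * P) ≤ Real.log (8 * 3 ^ m) := by
    rw [Real.log_mul (by norm_num) hP'.ne', Real.log_mul (by norm_num) (by positivity),
      Real.log_pow, show (27 : ℝ) = 3 ^ 3 by norm_num, show (8 : ℝ) = 2 ^ 3 by norm_num,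
      Real.log_pow, Real.log_pow]
    push_cast
    linarith
  have h6 := (Real.log_le_log_iff (by positivity) (by positivity)).1 h5
  rw [hPdef] at h6
  exact_mod_cast h6

variable {G} in
/-- In a colouring of a graph that is not `3`-colourable, every colour class has a vertex that sees
all other colours. -/
theorem exists_forall_ne_exists_adj (h3 : ¬ G.Colorable 3) {φ : V → Fin 4}
    (hφ : φ ∈ properColorings G) (c : Fin 4) :
    ∃ v, φ v = c ∧ ∀ d ≠ c, ∃ u, G.Adj u v ∧ φ u = d := by
  by_contra! h
  have h' : ∀ v, ∃ d, d ≠ c ∧ (φ v ≠ c → d = φ v) ∧ (φ v = c → ∀ u, G.Adj u v → φ u ≠ d) := by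
    intro v
    by_cases hv : φ v = c
    · obtain ⟨d, hd, hu⟩ := h v hv
      exact ⟨d, hd, fun h => (h hv).elim, fun _ => hu⟩
    · exact ⟨φ v, hv, fun _ => rfl, fun h => (hv h).elim⟩
  choose ψ hψ hψ1 hψ2 using h'
  have hproper : ∀ u v, G.Adj u v → ψ u ≠ ψ v := by
    intro u v huv heq
    have hne := mem_properColorings.1 hφ u v huv
    by_cases hu : φ u = c
    · have hv : φ v ≠ c := fun h => hne (hu.trans h.symm)
      exact hψ2 u hu v huv.symm (by rw [heq, hψ1 v hv])
    · by_cases hv : φ v = c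
      · exact hψ2 v hv u huv (by rw [← heq, hψ1 u hu])
      · exact hne (by rw [← hψ1 u hu, ← hψ1 v hv, heq])
  apply h3
  have hcard : Fintype.card {d : Fin 4 // d ≠ c} = 3 := by simp
  rw [← hcard]
  exact SimpleGraph.Coloring.colorable (SimpleGraph.Coloring.mk (fun v => ⟨ψ v, hψ v⟩)
    fun {u v} huv h => hproper u v huv (congrArg Subtype.val h))

variable {G} in
theorem exists_card_eq_four (h3 : ¬ G.Colorable 3) {φ : V → Fin 4}
    (hφ : φ ∈ properColorings G) : ∃ B : Finset V, #B = 4 ∧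
      ∀ v ∈ B, ∃ S : Finset V, (∀ s ∈ S, G.Adj s v) ∧ Set.InjOn φ S ∧ #S = 3 := by
  choose f hf hadj using exists_forall_ne_exists_adj h3 hφ
  refine ⟨univ.image f, ?_, ?_⟩
  · rw [card_image_of_injective, card_univ, Fintype.card_fin]
    intro c d h
    rw [← hf c, ← hf d, h]
  · intro v hv
    obtain ⟨c, -, rfl⟩ := mem_image.1 hv
    have : Nonempty V := ⟨f 0⟩
    choose! g hg hφg using hadj c
    refine ⟨({c}ᶜ : Finset (Fin 4)).image g, ?_, ?_, ?_⟩
    · intro s hs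
      obtain ⟨d, hd, rfl⟩ := mem_image.1 hs
      exact hg d (by simpa using hd)
    · intro s hs t ht hst
      simp only [coe_image, Set.mem_image, mem_coe, mem_compl, mem_singleton] at hs ht
      obtain ⟨d, hd, rfl⟩ := hs
      obtain ⟨e, he, rfl⟩ := ht
      rw [hφg d hd, hφg e he] at hst
      rw [hst]
    · rw [card_image_of_injOn]
      · simp [card_compl]
      · intro d hd e he h
        rw [← hφg d (by simpa using hd), ← hφg e (by simpa using he), h]

variable {G} in
/-- Identifying the vertices of a nonempty set `S` in a connected graph that is not
`3`-colourable. -/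
theorem exists_contraction (hG : G.Connected) (h3 : ¬ G.Colorable 3) {S : Finset V}
    (hS : S.Nonempty) (hind : ∀ s ∈ S, ∀ t ∈ S, ¬ G.Adj s t) :
    ∃ (W : Type) (_ : Fintype W) (H : SimpleGraph W), H.Connected ∧ ¬ H.Colorable 3 ∧
      Fintype.card W + #S = Fintype.card V + 1 ∧
      #{φ ∈ properColorings G | ∀ s ∈ S, ∀ t ∈ S, φ s = φ t} ≤ numColorings H 4 := by
  obtain ⟨x, hx⟩ := hS
  let W := {v // v ∉ S.erase x}
  let f : V → W := fun v => if h : v ∈ S then ⟨x, by simp⟩ else ⟨v, by simp [h]⟩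
  have hfS : ∀ v ∈ S, f v = ⟨x, by simp⟩ := fun v hv => dif_pos hv
  have hfS' : ∀ v ∉ S, (f v).1 = v := fun v hv => by simp [f, hv]
  have hf : Function.Surjective f := by
    rintro ⟨v, hv⟩
    refine ⟨v, ?_⟩
    by_cases h : v ∈ S
    · rw [hfS v h]
      have : v = x := by simpa [h] using hv
      simp [this]
    · exact Subtype.ext (hfS' v h)
  have hne : ∀ u v, G.Adj u v → f u ≠ f v := by
    intro u v huv h
    have h' := congrArg Subtype.val h
    by_cases hu : u ∈ S
    · by_cases hv : v ∈ S
      · exact hind u hu v hv huv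
      · rw [hfS u hu, hfS' v hv] at h'
        exact hv (h' ▸ hx)
    · by_cases hv : v ∈ S
      · rw [hfS v hv, hfS' u hu] at h'
        exact hu (h' ▸ hx)
      · rw [hfS' u hu, hfS' v hv] at h'
        exact huv.ne h'
  let H : SimpleGraph W :=
    { Adj := fun a b => ∃ u v, G.Adj u v ∧ f u = a ∧ f v = b
      symm := ⟨fun a b ⟨u, v, huv, hu, hv⟩ => ⟨v, u, huv.symm, hv, hu⟩⟩
      loopless := ⟨fun a ⟨u, v, huv, hu, hv⟩ => hne u v huv (hu.trans hv.symm)⟩ }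
  let F : G →g H := ⟨f, fun {u v} huv => ⟨u, v, huv, rfl, rfl⟩⟩
  refine ⟨W, inferInstance, H, hG.map F hf, fun h => h3 (h.of_hom F), ?_, ?_⟩
  · have h1 : Fintype.card W = Fintype.card V - #(S.erase x) := by
      rw [Fintype.card_subtype, ← card_compl]
      congr 1
      ext v
      simp [or_iff_not_imp_left]
    have h2 := card_le_univ (S.erase x)
    rw [card_erase_of_mem hx] at h1 h2
    have := card_pos.2 ⟨x, hx⟩
    omega
  · classical
    rw [numColorings_eq_card]
    refine card_le_card_of_injOn (fun φ w => φ w.1) ?_ ?_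
    · intro φ hφ
      obtain ⟨hφ, hconst⟩ := mem_filter.1 (mem_coe.1 hφ)
      have hφf : ∀ v, φ (f v).1 = φ v := by
        intro v
        by_cases hv : v ∈ S
        · rw [hfS v hv]
          exact hconst x hx v hv
        · rw [hfS' v hv]
      refine mem_coe.2 (mem_properColorings.2 ?_)
      rintro _ _ ⟨u, v, huv, rfl, rfl⟩
      change φ (f u).1 ≠ φ (f v).1
      rw [hφf, hφf]
      exact mem_properColorings.1 hφ u v huv
    · intro φ hφ ψ hψ h
      have hφ' := (mem_filter.1 (mem_coe.1 hφ)).2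
      have hψ' := (mem_filter.1 (mem_coe.1 hψ)).2
      have hW : ∀ v ∉ S.erase x, φ v = ψ v := fun v hv => congrFun h ⟨v, hv⟩
      ext1 v
      by_cases hv : v ∈ S
      · rw [hφ' v hv x hx, hψ' v hv x hx]
        exact hW x (by simp)
      · exact hW v fun h => hv (mem_of_mem_erase h)

/-- The functions vanishing outside `W` that are proper colourings on `W`. -/
def partialColorings (W : Finset V) : Finset (V → Fin 4) :=
  {φ | (∀ u ∈ W, ∀ v ∈ W, G.Adj u v → φ u ≠ φ v) ∧ ∀ v ∉ W, φ v = 0}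

variable {G} in
theorem card_partialColorings_insert_le {W : Finset V} {u w : V} (hu : u ∈ W) (hw : w ∉ W)
    (huw : G.Adj u w) :
    #(partialColorings G (insert w W)) ≤ 3 * #(partialColorings G W) := by
  refine card_le_mul_card_image_of_maps_to (f := fun φ => Function.update φ w 0) ?_ 3 ?_
  · intro φ hφ
    simp only [partialColorings, mem_filter, mem_univ, true_and] at hφ ⊢
    have hne : ∀ v ∈ W, v ≠ w := fun v hv h => hw (h ▸ hv)
    refine ⟨fun a ha b hb hab => ?_, fun v hv => ?_⟩
    · rw [Function.update_of_ne (hne a ha), Function.update_of_ne (hne b hb)]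
      exact hφ.1 a (mem_insert_of_mem ha) b (mem_insert_of_mem hb) hab
    · by_cases hvw : v = w
      · subst hvw; simp
      · rw [Function.update_of_ne hvw]
        exact hφ.2 v (by simp [hvw, hv])
  · intro ψ _
    have : #({ψ u}ᶜ : Finset (Fin 4)) = 3 := by simp [card_compl]
    have hne : u ≠ w := huw.ne
    refine (card_le_card_of_injOn (fun φ => φ w) ?_ ?_).trans this.le
    · intro φ hφ
      simp only [partialColorings, mem_coe, mem_filter, mem_univ, true_and] at hφ
      simp only [mem_coe, mem_compl, mem_singleton]
      rw [← hφ.2, Function.update_of_ne hne]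
      exact (hφ.1.1 u (mem_insert_of_mem hu) w (mem_insert_self w W) huw).symm
    · intro φ hφ χ hχ h
      have h1 := (mem_filter.1 (mem_coe.1 hφ)).2
      have h2 := (mem_filter.1 (mem_coe.1 hχ)).2
      ext1 v
      by_cases hv : v = w
      · subst hv; exact h
      · have := congrFun (h1.trans h2.symm) v
        simpa [Function.update_of_ne hv] using this

variable {G} in
theorem card_properColorings_le_partialColorings (hG : G.Connected) {W : Finset V}
    (hW : W.Nonempty) :
    #(properColorings G) ≤ 3 ^ #(Wᶜ) * #(partialColorings G W) := by
  induction h : #(Wᶜ) generalizing W with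
  | zero =>
    rw [card_eq_zero, compl_eq_empty_iff] at h
    subst h
    simp [properColorings, partialColorings]
  | succ k ih =>
    obtain ⟨u, hu⟩ := hW
    obtain ⟨w, hw⟩ : (Wᶜ).Nonempty := card_pos.1 (by omega)
    obtain ⟨p⟩ := hG.preconnected u w
    obtain ⟨d, -, hd1, hd2⟩ := p.exists_boundary_dart (W : Set V) hu (by simpa using hw)
    have hd2 : d.snd ∉ W := hd2
    have hcard : #((insert d.snd W)ᶜ) = k := by
      rw [compl_insert, card_erase_of_mem (by simpa using hd2)]
      omega
    calc
      _ ≤ 3 ^ k * #(partialColorings G (insert d.snd W)) := ih ⟨d.snd, mem_insert_self _ _⟩ hcard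
      _ ≤ 3 ^ k * (3 * #(partialColorings G W)) :=
        Nat.mul_le_mul_left _ (card_partialColorings_insert_le hd1 hd2 d.adj)
      _ = _ := by ring

/-- Deleting vertices from a connected graph loses a factor of at most three per vertex. -/
theorem numColorings_le_of_injective {G : SimpleGraph V} (hG : G.Connected) {W : Type} [Fintype W]
    [Nonempty W] (H : SimpleGraph W) {f : W → V} (hf : Function.Injective f)
    (hH : ∀ a b, H.Adj a b → G.Adj (f a) (f b)) :
    3 ^ Fintype.card W * numColorings G 4 ≤ 3 ^ Fintype.card V * numColorings H 4 := by
  classical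
  have hcard : #(univ.image f) = Fintype.card W := by
    rw [card_image_of_injective _ hf, card_univ]
  have h := card_properColorings_le_partialColorings hG (W := univ.image f) (by simp)
  have h2 : #(partialColorings G (univ.image f)) ≤ #(properColorings H) := by
    refine card_le_card_of_injOn (fun φ => φ ∘ f) ?_ ?_
    · intro φ hφ
      have hφ := (mem_filter.1 (mem_coe.1 hφ)).2
      exact mem_coe.2 (mem_properColorings.2 fun a b hab =>
        hφ.1 _ (by simp) _ (by simp) (hH a b hab))
    · intro φ hφ ψ hψ h
      have hφ := (mem_filter.1 (mem_coe.1 hφ)).2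
      have hψ := (mem_filter.1 (mem_coe.1 hψ)).2
      ext1 v
      by_cases hv : v ∈ univ.image f
      · obtain ⟨a, -, rfl⟩ := mem_image.1 hv
        exact congrFun h a
      · rw [hφ.2 v hv, hψ.2 v hv]
  have hle := Fintype.card_le_of_injective f hf
  rw [numColorings_eq_card, numColorings_eq_card]
  calc
    _ ≤ 3 ^ Fintype.card W * (3 ^ #((univ.image f)ᶜ) * #(properColorings H)) := by
      gcongr
      exact h.trans (Nat.mul_le_mul_left _ h2)
    _ = _ := by
      rw [card_compl, hcard, ← mul_assoc, ← pow_add, Nat.add_sub_cancel' hle]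

variable {G} in
/-- If deleting `v` makes `G` `3`-colourable, then `v` has at least three neighbours. -/
theorem three_le_degree (h3 : ¬ G.Colorable 3) {v : V}
    (hv : (G.induce {u | u ≠ v}).Colorable 3) : 3 ≤ #{u | G.Adj u v} := by
  by_contra! hlt
  obtain ⟨c⟩ := hv
  let ψ : V → Fin 3 := fun u => if h : u ≠ v then c ⟨u, h⟩ else 0
  have hψ : ∀ u w, u ≠ v → w ≠ v → G.Adj u w → ψ u ≠ ψ w := by
    intro u w hu hw huw
    simp only [ψ, dif_pos hu, dif_pos hw]
    exact c.valid (by simpa using huw)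
  obtain ⟨d, hd⟩ : ∃ d, d ∉ image ψ {u | G.Adj u v} := by
    by_contra! hall
    have h1 : #(univ : Finset (Fin 3)) ≤ #(image ψ {u | G.Adj u v}) :=
      card_le_card fun d _ => hall d
    have h2 := h1.trans card_image_le
    rw [card_univ, Fintype.card_fin] at h2
    omega
  have hd' : ∀ u, G.Adj u v → ψ u ≠ d := fun u hu h =>
    hd (mem_image.2 ⟨u, by simpa using hu, h⟩)
  refine h3 ⟨SimpleGraph.Coloring.mk (Function.update ψ v d) fun {u w} huw => ?_⟩
  by_cases hu : u = v
  · subst hu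
    rw [Function.update_self, Function.update_of_ne huw.ne']
    exact (hd' w huw.symm).symm
  · by_cases hw : w = v
    · subst hw
      rw [Function.update_self, Function.update_of_ne hu]
      exact hd' u huw
    · rw [Function.update_of_ne hu, Function.update_of_ne hw]
      exact hψ u w hu hw huw

end Colourings

/-- A connected graph on `n` vertices that is not `3`-colourable has at most `24 * 3 ^ (n - 4)`
colourings with four colours. -/
theorem mul_numColorings_le_of_not_colorable {V : Type} [Fintype V] (G : SimpleGraph V)
    (hG : G.Connected) (h3 : ¬ G.Colorable 3) :
    27 * numColorings G 4 ≤ 8 * 3 ^ Fintype.card V := by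
  classical
  induction hn : Fintype.card V using Nat.strong_induction_on generalizing V with
  | _ n ih =>
  by_cases hdel : ∃ v, ¬ (G.induce {u | u ≠ v}).Colorable 3
  · obtain ⟨v, hv⟩ := hdel
    rw [SimpleGraph.colorable_iff_forall_connectedComponent] at hv
    push Not at hv
    obtain ⟨C, hC⟩ := hv
    have hconn := C.connected_toSimpleGraph
    have := hconn.nonempty
    let f : C → V := fun a => a.1.1
    have hf : Function.Injective f := fun a b h => Subtype.ext (Subtype.ext h)
    have hlt : Fintype.card C < n := by
      rw [← hn]
      refine Fintype.card_lt_of_injective_not_surjective f hf fun hs => ?_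
      obtain ⟨a, ha⟩ := hs v
      exact a.1.2 ha
    have h1 := ih _ hlt C.toSimpleGraph hconn hC rfl
    have h2 := numColorings_le_of_injective hG C.toSimpleGraph hf fun a b hab => hab
    rw [hn] at h2
    refine Nat.le_of_mul_le_mul_left (c := 3 ^ Fintype.card C) ?_ (by positivity)
    nlinarith [Nat.mul_le_mul_left (3 ^ n) h1]
  push Not at hdel
  have hdeg := fun v => three_le_degree h3 (hdel v)
  choose N hNsub hN3 using fun v => exists_subset_card_eq (hdeg v)
  have hN : ∀ v, ∀ s ∈ N v, G.Adj s v := fun v s hs => by simpa using hNsub v hs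
  by_contra! hlt
  rw [numColorings_eq_card] at hlt
  refine hlt.not_ge (hn ▸ mul_card_properColorings_le N hN hN3
    (fun φ hφ => exists_card_eq_four h3 hφ) ?_)
  rw [hn]
  set E := ∑ v, #{φ ∈ properColorings G | ∀ s ∈ N v, ∀ t ∈ N v, φ s = φ t} with hE
  have hmono : ∀ v, 9 * #{φ ∈ properColorings G | ∀ s ∈ N v, ∀ t ∈ N v, φ s = φ t} ≤
      #(properColorings G) := by
    intro v
    obtain h0 | ⟨φ, hφ⟩ :=
      {φ ∈ properColorings G | ∀ s ∈ N v, ∀ t ∈ N v, φ s = φ t}.eq_empty_or_nonempty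
    · simp [h0]
    obtain ⟨hφ, hconst⟩ := mem_filter.1 hφ
    obtain ⟨W, _, H, hH, hH3, hcard, hle⟩ := exists_contraction hG h3 (S := N v)
      (card_pos.1 (by rw [hN3]; norm_num))
      (fun s hs t ht hst => mem_properColorings.1 hφ s t hst (hconst s hs t ht))
    rw [hN3, hn] at hcard
    have h1 := ih (Fintype.card W) (by omega) H hH hH3 rfl
    have h2 : 3 ^ n = 9 * 3 ^ Fintype.card W := by
      rw [show n = Fintype.card W + 2 by omega, pow_add]; ring
    omega
  have hEle : 9 * E ≤ n * #(properColorings G) := by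
    rw [hE, mul_sum, ← hn, ← card_univ, ← smul_eq_mul, ← sum_const]
    exact sum_le_sum fun v _ => hmono v
  have h4 : 4 ≤ n := by
    have := hG.nonempty
    obtain ⟨v⟩ := this
    have hv : v ∉ N v := fun h => (hN v v h).ne rfl
    have := card_le_univ (insert v (N v))
    rwa [card_insert_of_notMem hv, hN3, hn] at this
  have h6 : E = 0 ∨ 6 ≤ n := by
    by_contra! h
    obtain ⟨v, -, hv⟩ := exists_ne_zero_of_sum_ne_zero h.1
    obtain ⟨φ, hφ⟩ := card_pos.1 (Nat.pos_of_ne_zero hv)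
    obtain ⟨hφ, hconst⟩ := mem_filter.1 hφ
    obtain ⟨s, hs⟩ := card_pos.1 (show 0 < #(N v) by rw [hN3]; norm_num)
    have hdisj : Disjoint (N s) (N v) := by
      rw [disjoint_left]
      exact fun t ht ht' => mem_properColorings.1 hφ t s (hN s t ht) (hconst t ht' s hs)
    have := card_le_univ (N s ∪ N v)
    rw [card_union_of_disjoint hdisj, hN3, hN3, hn] at this
    omega
  have hab : 30 * Real.log 2 ≤ 19 * Real.log 3 := by
    have : Real.log ((2 : ℝ) ^ 30) ≤ Real.log ((3 : ℝ) ^ 19) :=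
      Real.log_le_log (by norm_num) (by norm_num)
    rw [Real.log_pow, Real.log_pow] at this
    exact_mod_cast this
  have ha : 0 < Real.log 2 := Real.log_pos (by norm_num)
  have hP : (0 : ℝ) ≤ #(properColorings G) := Nat.cast_nonneg _
  have h4' : (4 : ℝ) ≤ n := by exact_mod_cast h4
  obtain h0 | h6 := h6
  · rw [h0, Nat.cast_zero, mul_zero]
    refine mul_nonneg (mul_nonneg ?_ ?_) hP <;> linarith
  · have h6' : (6 : ℝ) ≤ n := by exact_mod_cast h6
    have hEle' : 9 * (E : ℝ) ≤ n * #(properColorings G) := by exact_mod_cast hEle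
    have hcoef : (5 * Real.log 3 - 6 * Real.log 2) * n ≤
        9 * (4 * (2 * Real.log 3 - 3 * Real.log 2) * (n - 4)) := by
      nlinarith
    have h7 := mul_le_mul_of_nonneg_left hEle'
      (show 0 ≤ 5 * Real.log 3 - 6 * Real.log 2 by linarith)
    have h8 := mul_le_mul_of_nonneg_right hcoef hP
    linarith

/-- Every connected graph `G` on `n` vertices with chromatic number exactly `4` has at most
`4!·3^(n-4)` proper colourings with `4` labelled colours. -/
theorem tomescu_four_colourings {V : Type} [Fintype V] (G : SimpleGraph V)
    (hconn : G.Connected) (hchrom : G.chromaticNumber = 4) :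
    numColorings G 4 ≤ Nat.factorial 4 * 3 ^ (Fintype.card V - 4) := by
  have h3 : ¬ G.Colorable 3 := by
    intro h
    have := h.chromaticNumber_le
    rw [hchrom] at this
    exact absurd this (by decide)
  have h4 : 4 ≤ Fintype.card V := by
    by_contra! h
    exact h3 (G.colorable_of_fintype.mono (by omega))
  have h := mul_numColorings_le_of_not_colorable G hconn h3
  have h2 : 3 ^ Fintype.card V = 81 * 3 ^ (Fintype.card V - 4) := by
    rw [show (81 : ℕ) = 3 ^ 4 by norm_num, ← pow_add, Nat.add_sub_cancel' h4]
  rw [show Nat.factorial 4 = 24 by rfl]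
  omega
end
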